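/- arXiv:2505.08015 — 11 statements merged into one kernel-verified Lean document; each statement's English description precedes it below -/
import Mathlib

section
/- Let A, B, C, D be four distinct points in ℝ² lying on a circle in anticlockwise order (in this order). Writing, for points P, Q, T, x(P,Q) for the squared distance and S(P,Q,T) for four times the signed area, and abbreviating x_{PQ} := x(P,Q), S_{PQT} := S(P,Q,T), the following three 3×3 determinants vanish: det [[x_{CD}, S_{ACD}, S_{BCD}], [−x_{AB}, S_{ABC}, S_{ABD}], [0, x_{AC}, x_{BD}]] = 0; det [[x_{CD}, S_{ACD}, S_{BCD}], [x_{AB}, S_{ABD}, S_{ABC}], [0, x_{AD}, x_{BC}]] = 0; det [[x_{BC}, S_{ABC}, S_{BCD}], [−x_{AD}, S_{ACD}, S_{ABD}], [0, x_{AC}, x_{BD}]] = 0. -/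
/-- Squared distance between two points of `ℝ × ℝ`. -/
noncomputable def sqDist (P Q : ℝ × ℝ) : ℝ := (Q.1 - P.1)^2 + (Q.2 - P.2)^2

/-- Four times the signed area of the triangle `P Q T`. -/
noncomputable def S4 (P Q T : ℝ × ℝ) : ℝ :=
  2 * ((Q.1 - P.1) * (T.2 - P.2) - (Q.2 - P.2) * (T.1 - P.1))

def wd (c s c' s' : ℝ) : ℝ := s' * c - c' * s

lemma sqDist_half (O : ℝ × ℝ) (R p q : ℝ) :
    sqDist (O.1 + R * Real.cos p, O.2 + R * Real.sin p) (O.1 + R * Real.cos q, O.2 + R * Real.sin q)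
      = 4 * R ^ 2 * (wd (Real.cos (p/2)) (Real.sin (p/2)) (Real.cos (q/2)) (Real.sin (q/2))) ^ 2 := by
  have e : ∀ t : ℝ, Real.cos t = Real.cos (t/2) ^ 2 - Real.sin (t/2) ^ 2 ∧
      Real.sin t = 2 * Real.sin (t/2) * Real.cos (t/2) := fun t => by
    rw [← Real.cos_two_mul', ← Real.sin_two_mul]
    constructor <;> congr 1 <;> ring
  unfold sqDist wd
  rw [(e p).1, (e p).2, (e q).1, (e q).2]
  have hp := Real.sin_sq_add_cos_sq (p/2)
  have hq := Real.sin_sq_add_cos_sq (q/2)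
  generalize Real.cos (p/2) = c, Real.sin (p/2) = s at *
  generalize Real.cos (q/2) = c', Real.sin (q/2) = s' at *
  linear_combination R^2 * ((s^2+c^2+1 - 2*(s'^2+c'^2)) * hp + (s'^2+c'^2 - 1) * hq)

lemma S4_half (O : ℝ × ℝ) (R p q t : ℝ) :
    S4 (O.1 + R * Real.cos p, O.2 + R * Real.sin p) (O.1 + R * Real.cos q, O.2 + R * Real.sin q)
      (O.1 + R * Real.cos t, O.2 + R * Real.sin t)
      = 8 * R ^ 2 * (wd (Real.cos (p/2)) (Real.sin (p/2)) (Real.cos (q/2)) (Real.sin (q/2)) *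
        wd (Real.cos (q/2)) (Real.sin (q/2)) (Real.cos (t/2)) (Real.sin (t/2)) *
        wd (Real.cos (p/2)) (Real.sin (p/2)) (Real.cos (t/2)) (Real.sin (t/2))) := by
  have e : ∀ t : ℝ, Real.cos t = Real.cos (t/2) ^ 2 - Real.sin (t/2) ^ 2 ∧
      Real.sin t = 2 * Real.sin (t/2) * Real.cos (t/2) := fun t => by
    rw [← Real.cos_two_mul', ← Real.sin_two_mul]
    constructor <;> congr 1 <;> ring
  unfold S4 wd
  rw [(e p).1, (e p).2, (e q).1, (e q).2, (e t).1, (e t).2]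
  have hp := Real.sin_sq_add_cos_sq (p/2)
  have hq := Real.sin_sq_add_cos_sq (q/2)
  have ht := Real.sin_sq_add_cos_sq (t/2)
  generalize Real.cos (p/2) = c, Real.sin (p/2) = s at *
  generalize Real.cos (q/2) = c', Real.sin (q/2) = s' at *
  generalize Real.cos (t/2) = c2, Real.sin (t/2) = s2 at *
  -- cross(p,q) + cross(q,t) + cross(t,p), homogenised
  linear_combination (-4 * R^2) * (
      (((c'^2-s'^2)*(s2*c2) - (s'*c')*(c2^2-s2^2)) * hp
      + ((c2^2-s2^2)*(s*c) - (s2*c2)*(c^2-s^2)) * hq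
      + ((c^2-s^2)*(s'*c') - (s*c)*(c'^2-s'^2)) * ht))

lemma key (a1 a2 b1 b2 c1 c2 d1 d2 : ℝ) (ha : a2^2+a1^2=1) (hb : b2^2+b1^2=1)
    (hc : c2^2+c1^2=1) (hd : d2^2+d1^2=1) :
    wd b1 b2 d1 d2 * (wd b1 b2 c1 c2 * wd c1 c2 d1 d2 + wd a1 a2 b1 b2 * wd a1 a2 d1 d2)
     = wd a1 a2 c1 c2 * (wd a1 a2 b1 b2 * wd b1 b2 c1 c2 + wd c1 c2 d1 d2 * wd a1 a2 d1 d2) := by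
  unfold wd
  linear_combination
    (-(d2*b1-d1*b2)*(c2*b1-c1*b2)*(d2*c1-d1*c2)) * ha
    + (-(d2*b1-d1*b2)*(b2*a1-b1*a2)*(d2*a1-d1*a2)) * hc
    + ((c2*a1-c1*a2)*(b2*a1-b1*a2)*(c2*b1-c1*b2)) * hd
    + ((c2*a1-c1*a2)*(d2*c1-d1*c2)*(d2*a1-d1*a2)) * hb

theorem stmt0 (A B C D : ℝ × ℝ)
    (hdist : A ≠ B ∧ A ≠ C ∧ A ≠ D ∧ B ≠ C ∧ B ≠ D ∧ C ≠ D)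
    (hcirc : ∃ (O : ℝ × ℝ) (R tA tB tC tD : ℝ), 0 < R ∧
      tA < tB ∧ tB < tC ∧ tC < tD ∧ tD < tA + 2 * Real.pi ∧
      A = (O.1 + R * Real.cos tA, O.2 + R * Real.sin tA) ∧
      B = (O.1 + R * Real.cos tB, O.2 + R * Real.sin tB) ∧
      C = (O.1 + R * Real.cos tC, O.2 + R * Real.sin tC) ∧
      D = (O.1 + R * Real.cos tD, O.2 + R * Real.sin tD)) :
    (Matrix.det !![sqDist C D, S4 A C D, S4 B C D;
                   -sqDist A B, S4 A B C, S4 A B D;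
                   0, sqDist A C, sqDist B D] = 0) ∧
    (Matrix.det !![sqDist C D, S4 A C D, S4 B C D;
                   sqDist A B, S4 A B D, S4 A B C;
                   0, sqDist A D, sqDist B C] = 0) ∧
    (Matrix.det !![sqDist B C, S4 A B C, S4 B C D;
                   -sqDist A D, S4 A C D, S4 A B D;
                   0, sqDist A C, sqDist B D] = 0) := by
  obtain ⟨O, R, p, q, r, t, -, -, -, -, -, rfl, rfl, rfl, rfl⟩ := hcirc
  have k := key _ _ _ _ _ _ _ _ (Real.sin_sq_add_cos_sq (p/2)) (Real.sin_sq_add_cos_sq (q/2))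
    (Real.sin_sq_add_cos_sq (r/2)) (Real.sin_sq_add_cos_sq (t/2))
  simp only [Matrix.det_fin_three, sqDist_half, S4_half]
  simp only [Matrix.of_apply, Matrix.cons_val', Matrix.cons_val_zero, Matrix.cons_val_one,
    Matrix.cons_val, Matrix.cons_val_fin_one]
  generalize wd (Real.cos (p/2)) (Real.sin (p/2)) (Real.cos (q/2)) (Real.sin (q/2)) = a at *
  generalize wd (Real.cos (q/2)) (Real.sin (q/2)) (Real.cos (r/2)) (Real.sin (r/2)) = b at *
  generalize wd (Real.cos (r/2)) (Real.sin (r/2)) (Real.cos (t/2)) (Real.sin (t/2)) = c at *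
  generalize wd (Real.cos (p/2)) (Real.sin (p/2)) (Real.cos (t/2)) (Real.sin (t/2)) = d at *
  generalize wd (Real.cos (p/2)) (Real.sin (p/2)) (Real.cos (r/2)) (Real.sin (r/2)) = e at *
  generalize wd (Real.cos (q/2)) (Real.sin (q/2)) (Real.cos (t/2)) (Real.sin (t/2)) = f at *
  refine ⟨?_, ?_, ?_⟩
  · linear_combination 128 * R^6 * (a*c*e*f) * k
  · linear_combination 128 * R^6 * (a*b*c*d) * k
  · linear_combination 128 * R^6 * (b*d*e*f) * k
end

section
/- Let n ≥ 3 and let A : ℤ → ℝ² be n-periodic (A_{i+n} = A_i) with A_1, …, A_n lying on a circle in anticlockwise order. Then for all integers a and b the following three 3×3 determinants vanish: det [[x_{b,b+1}, S_{a,b,b+1}, S_{a+1,b,b+1}], [−x_{a,a+1}, S_{a,a+1,b}, S_{a,a+1,b+1}], [0, x_{a,b}, x_{a+1,b+1}]] = 0; det [[x_{b,b+1}, S_{a,b,b+1}, S_{a+1,b,b+1}], [x_{a,a+1}, S_{a,a+1,b+1}, S_{a,a+1,b}], [0, x_{a,b+1}, x_{a+1,b}]] = 0; det [[x_{a+1,b},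 S_{a,a+1,b}, S_{a+1,b,b+1}], [−x_{a,b+1}, S_{a,b,b+1}, S_{a,a+1,b+1}], [0, x_{a,b}, x_{a+1,b+1}]] = 0. (This covers every diamond of the polygonal Heronian frieze, including the top and bottom rows b = a∓1 and the gluing diamonds b = a.) -/
/-- The points `A lo, A (lo+1), …, A hi` lie on a circle in anticlockwise order. -/
def Anticlockwise (A : ℤ → ℝ × ℝ) (lo hi : ℤ) : Prop :=
  ∃ (O : ℝ × ℝ) (R : ℝ) (θ : ℤ → ℝ), 0 < R ∧
    (∀ i, lo ≤ i → i < hi → θ i < θ (i + 1)) ∧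
    θ hi < θ lo + 2 * Real.pi ∧
    ∀ i, lo ≤ i → i ≤ hi → A i = (O.1 + R * Real.cos (θ i), O.2 + R * Real.sin (θ i))

/-- Signed chord factor. -/
noncomputable def chd (c s : ℝ) (c' s' : ℝ) : ℝ := s' * c - c' * s

lemma sq_aux (o p R c s c' s' : ℝ) (h : c^2+s^2=1) (h' : c'^2+s'^2=1) :
    sqDist (o + R * (c^2-s^2), p + R * (2*s*c)) (o + R * (c'^2-s'^2), p + R * (2*s'*c'))
      = 4 * R^2 * (chd c s c' s')^2 := by
  have e : sqDist (o + R * (c^2-s^2), p + R * (2*s*c)) (o + R * (c'^2-s'^2), p + R * (2*s'*c'))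
      = R^2 * ((c^2+s^2)^2 + (c'^2+s'^2)^2 - 2 * (c^2+s^2) * (c'^2+s'^2))
        + 4 * R^2 * (chd c s c' s')^2 := by
    simp only [sqDist, chd]; ring
  rw [e, h, h']; ring

lemma S4_aux (o p R c s c' s' c'' s'' : ℝ) (h : c^2+s^2=1) (h' : c'^2+s'^2=1)
    (h'' : c''^2+s''^2=1) :
    S4 (o + R * (c^2-s^2), p + R * (2*s*c)) (o + R * (c'^2-s'^2), p + R * (2*s'*c'))
       (o + R * (c''^2-s''^2), p + R * (2*s''*c''))
      = 8 * R^2 * (chd c s c' s' * chd c' s' c'' s'' * chd c s c'' s'') := by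
  have e : S4 (o + R * (c^2-s^2), p + R * (2*s*c)) (o + R * (c'^2-s'^2), p + R * (2*s'*c'))
       (o + R * (c''^2-s''^2), p + R * (2*s''*c''))
      = 4 * R^2 * (((c^2-s^2)*(s'*c')-(s*c)*(c'^2-s'^2))
        + ((c'^2-s'^2)*(s''*c'')-(s'*c')*(c''^2-s''^2))
        + ((c''^2-s''^2)*(s*c)-(s''*c'')*(c^2-s^2))) := by
    simp only [S4]; ring
  have f : 4 * R^2 * (((c^2-s^2)*(s'*c')-(s*c)*(c'^2-s'^2)) * (c''^2+s''^2)
        + ((c'^2-s'^2)*(s''*c'')-(s'*c')*(c''^2-s''^2)) * (c^2+s^2)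
        + ((c''^2-s''^2)*(s*c)-(s''*c'')*(c^2-s^2)) * (c'^2+s'^2))
      = 8 * R^2 * (chd c s c' s' * chd c' s' c'' s'' * chd c s c'' s'') := by
    simp only [chd]; ring
  rw [h, h', h''] at f
  rw [e, ← f]; ring

lemma ptol (a a' b b' c c' d d' : ℝ) (ha : a^2+a'^2=1) (hb : b^2+b'^2=1)
    (hc : c^2+c'^2=1) (hd : d^2+d'^2=1) :
    chd b b' d d' * chd c c' d d' * chd b b' c c' + chd a a' b b' * chd a a' d d' * chd b b' d d'
    - chd a a' c c' * chd c c' d d' * chd a a' d d' - chd a a' b b' * chd b b' c c' * chd a a' c c' = 0 := by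
  have e : chd b b' d d' * chd c c' d d' * chd b b' c c' * (a^2+a'^2)
    + chd a a' b b' * chd a a' d d' * chd b b' d d' * (c^2+c'^2)
    - chd a a' c c' * chd c c' d d' * chd a a' d d' * (b^2+b'^2)
    - chd a a' b b' * chd b b' c c' * chd a a' c c' * (d^2+d'^2) = 0 := by
    simp only [chd]; ring
  rw [ha, hb, hc, hd] at e
  linarith

lemma exists_param (n : ℤ) (hn : 3 ≤ n) (A : ℤ → ℝ × ℝ)
    (hper : ∀ i, A (i + n) = A i) (hcirc : Anticlockwise A 1 n) :
    ∃ o p R : ℝ, ∀ i, ∃ c s : ℝ, c^2+s^2=1 ∧ A i = (o + R * (c^2-s^2), p + R * (2*s*c)) := by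
  obtain ⟨O, R, θ, -, -, -, h⟩ := hcirc
  refine ⟨O.1, O.2, R, fun i => ?_⟩
  have hP : Function.Periodic A n := hper
  have h1 : A i = A ((i-1) % n + 1) := by
    have h2 := hP.int_mul ((i-1)/n) ((i-1) % n + 1)
    rw [← h2]
    congr 1
    have := Int.emod_add_mul_ediv (i-1) n
    simp only [Int.cast_id]
    linarith
  have h3 := Int.emod_nonneg (i-1) (show n ≠ 0 by omega)
  have h4 := Int.emod_lt_of_pos (i-1) (show 0 < n by omega)
  have h5 := h ((i-1) % n + 1) (by omega) (by omega)
  set t := θ ((i-1) % n + 1)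
  refine ⟨Real.cos (t/2), Real.sin (t/2), Real.cos_sq_add_sin_sq _, ?_⟩
  rw [h1, h5, ← Real.cos_two_mul', ← Real.sin_two_mul, mul_div_cancel₀ t two_ne_zero]

theorem stmt1 (n : ℤ) (hn : 3 ≤ n) (A : ℤ → ℝ × ℝ)
    (hper : ∀ i, A (i + n) = A i)
    (hcirc : Anticlockwise A 1 n)
    (a b : ℤ) :
    (Matrix.det !![sqDist (A b) (A (b+1)), S4 (A a) (A b) (A (b+1)), S4 (A (a+1)) (A b) (A (b+1));
                   -sqDist (A a) (A (a+1)), S4 (A a) (A (a+1)) (A b), S4 (A a) (A (a+1)) (A (b+1));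
                   0, sqDist (A a) (A b), sqDist (A (a+1)) (A (b+1))] = 0) ∧
    (Matrix.det !![sqDist (A b) (A (b+1)), S4 (A a) (A b) (A (b+1)), S4 (A (a+1)) (A b) (A (b+1));
                   sqDist (A a) (A (a+1)), S4 (A a) (A (a+1)) (A (b+1)), S4 (A a) (A (a+1)) (A b);
                   0, sqDist (A a) (A (b+1)), sqDist (A (a+1)) (A b)] = 0) ∧
    (Matrix.det !![sqDist (A (a+1)) (A b), S4 (A a) (A (a+1)) (A b), S4 (A (a+1)) (A b) (A (b+1));
                   -sqDist (A a) (A (b+1)), S4 (A a) (A b) (A (b+1)), S4 (A a) (A (a+1)) (A (b+1));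
                   0, sqDist (A a) (A b), sqDist (A (a+1)) (A (b+1))] = 0) := by
  obtain ⟨o, p, R, h⟩ := exists_param n hn A hper hcirc
  obtain ⟨a1, a2, ha, ea⟩ := h a
  obtain ⟨b1, b2, hb, eb⟩ := h (a+1)
  obtain ⟨c1, c2, hc, ec⟩ := h b
  obtain ⟨d1, d2, hd, ed⟩ := h (b+1)
  have P := ptol a1 a2 b1 b2 c1 c2 d1 d2 ha hb hc hd
  have P2 := ptol a1 a2 b1 b2 d1 d2 c1 c2 ha hb hd hc
  have P3 := ptol a1 a2 c1 c2 b1 b2 d1 d2 ha hc hb hd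
  have dc : chd d1 d2 c1 c2 = - chd c1 c2 d1 d2 := by simp only [chd]; ring
  have cb : chd c1 c2 b1 b2 = - chd b1 b2 c1 c2 := by simp only [chd]; ring
  rw [dc] at P2
  rw [cb] at P3
  rw [ea, eb, ec, ed]
  simp only [Matrix.det_fin_three, sq_aux, S4_aux, ha, hb, hc, hd]
  simp [sq_aux, S4_aux, ha, hb, hc, hd]
  generalize chd a1 a2 b1 b2 = AB at *
  generalize chd a1 a2 c1 c2 = AC at *
  generalize chd a1 a2 d1 d2 = AD at *
  generalize chd b1 b2 c1 c2 = BC at *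
  generalize chd b1 b2 d1 d2 = BD at *
  generalize chd c1 c2 d1 d2 = CD at *
  refine ⟨?_, ?_, ?_⟩
  · linear_combination (128 * R^6 * AB * CD * AC * BD) * P
  · linear_combination (-128 * R^6 * AB * CD * AD * BC) * P2
  · linear_combination (-128 * R^6 * AD * BC * AC * BD) * P3
end

section
/- Let m ≥ 2 be an integer and let A_1, A_2, …, A_{m+1} be points in ℝ² lying on a circle in anticlockwise order. Then S_{1,m,m+1} · ∏_{i=2}^{m−1} x_{i,m+1} = Σ_{j=1}^{m−1} S_{j,j+1,m+1} · ∏_{k ∈ {1,…,m}, k ≠ j, k ≠ j+1} x_{k,m+1}. -/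
open Finset

/-- The points `A lo, A (lo+1), …, A hi` lie on a circle in anticlockwise order. -/
def AnticlockwiseN (A : ℕ → ℝ × ℝ) (lo hi : ℕ) : Prop :=
  ∃ (O : ℝ × ℝ) (R : ℝ) (θ : ℕ → ℝ), 0 < R ∧
    (∀ i, lo ≤ i → i < hi → θ i < θ (i + 1)) ∧
    θ hi < θ lo + 2 * Real.pi ∧
    ∀ i, lo ≤ i → i ≤ hi → A i = (O.1 + R * Real.cos (θ i), O.2 + R * Real.sin (θ i))


lemma aux_three (O T P Q W : ℝ × ℝ) (R : ℝ)
    (hT : (T.1 - O.1)^2 + (T.2 - O.2)^2 = R^2)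
    (hP : (P.1 - O.1)^2 + (P.2 - O.2)^2 = R^2)
    (hQ : (Q.1 - O.1)^2 + (Q.2 - O.2)^2 = R^2)
    (hW : (W.1 - O.1)^2 + (W.2 - O.2)^2 = R^2) :
    S4 P W T * sqDist Q T = S4 P Q T * sqDist W T + S4 Q W T * sqDist P T := by
  have key : ∀ U : ℝ × ℝ, (U.1 - O.1)^2 + (U.2 - O.2)^2 = R^2 →
      sqDist U T = 2 * ((O.1 - T.1) * (U.1 - T.1) + (O.2 - T.2) * (U.2 - T.2)) := by
    intro U hU
    unfold sqDist
    linear_combination hU - hT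
  rw [key P hP, key Q hQ, key W hW]
  unfold S4
  ring

lemma aux_sum (m : ℕ) (x : ℕ → ℝ) (S : ℕ → ℕ → ℝ)
    (h : ∀ n, 1 ≤ n → n < m → S 1 (n+1) * x n = S 1 n * x (n+1) + S n (n+1) * x 1)
    (n : ℕ) (hn : 2 ≤ n) : n ≤ m →
    S 1 n * ∏ i ∈ Finset.Icc 2 (n-1), x i =
      ∑ j ∈ Finset.Icc 1 (n-1), S j (j+1) *
        ∏ k ∈ (Finset.Icc 1 n).filter (fun k => k ≠ j ∧ k ≠ j + 1), x k := by
  induction n, hn using Nat.le_induction with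
  | base =>
    intro _
    have : (Finset.Icc 1 2).filter (fun k => k ≠ 1 ∧ k ≠ 1 + 1) = ∅ := by decide
    simp [this]
  | succ n hn ih =>
    intro hm
    have ih := ih (by omega)
    obtain ⟨k, rfl⟩ : ∃ k, n = k + 2 := ⟨n - 2, by omega⟩
    have e1 : k + 2 + 1 - 1 = (k + 1) + 1 := by omega
    have e2 : k + 2 - 1 = k + 1 := by omega
    rw [e2] at ih
    rw [e1, Finset.prod_Icc_succ_top (by omega), Finset.sum_Icc_succ_top (by omega)]
    have h1 : ∀ j ∈ Finset.Icc 1 (k+1), S j (j+1) *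
        ∏ i ∈ (Finset.Icc 1 (k+2+1)).filter (fun i => i ≠ j ∧ i ≠ j + 1), x i =
        (S j (j+1) *
        ∏ i ∈ (Finset.Icc 1 (k+2)).filter (fun i => i ≠ j ∧ i ≠ j + 1), x i) * x (k+2+1) := by
      intro j hj
      rw [Finset.mem_Icc] at hj
      have : (Finset.Icc 1 (k+2+1)).filter (fun i => i ≠ j ∧ i ≠ j + 1) =
          insert (k+2+1) ((Finset.Icc 1 (k+2)).filter (fun i => i ≠ j ∧ i ≠ j + 1)) := by
        ext i
        simp only [Finset.mem_filter, Finset.mem_Icc, Finset.mem_insert]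
        omega
      rw [this, Finset.prod_insert (by simp)]
      ring
    have h2 : (Finset.Icc 1 (k+2+1)).filter (fun i => i ≠ k+1+1 ∧ i ≠ k+1+1 + 1) =
        insert 1 (Finset.Icc 2 (k+1)) := by
      ext i
      simp only [Finset.mem_filter, Finset.mem_Icc, Finset.mem_insert]
      omega
    rw [Finset.sum_congr rfl h1, ← Finset.sum_mul, ← ih, h2, Finset.prod_insert (by simp)]
    have h3 := h (k+2) (by omega) (by omega)
    rw [show k + 1 + 1 = k + 2 from rfl]
    linear_combination (∏ i ∈ Finset.Icc 2 (k+1), x i) * h3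

theorem stmt2 (m : ℕ) (hm : 2 ≤ m) (A : ℕ → ℝ × ℝ)
    (hcirc : AnticlockwiseN A 1 (m + 1)) :
    S4 (A 1) (A m) (A (m+1)) * ∏ i ∈ Finset.Icc 2 (m-1), sqDist (A i) (A (m+1)) =
      ∑ j ∈ Finset.Icc 1 (m-1), S4 (A j) (A (j+1)) (A (m+1)) *
        ∏ k ∈ (Finset.Icc 1 m).filter (fun k => k ≠ j ∧ k ≠ j + 1),
          sqDist (A k) (A (m+1)) := by
  obtain ⟨O, R, θ, -, -, -, hA⟩ := hcirc
  have hc : ∀ i, 1 ≤ i → i ≤ m + 1 → ((A i).1 - O.1)^2 + ((A i).2 - O.2)^2 = R^2 := by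
    intro i h1 h2
    rw [hA i h1 h2]
    linear_combination R^2 * Real.sin_sq_add_cos_sq (θ i)
  refine aux_sum m (fun i => sqDist (A i) (A (m+1))) (fun i j => S4 (A i) (A j) (A (m+1)))
    ?_ m hm le_rfl
  intro n h1 h2
  exact aux_three O _ _ _ _ R (hc _ (by omega) (by omega)) (hc _ (by omega) (by omega))
    (hc _ (by omega) (by omega)) (hc _ (by omega) (by omega))
end

section
/- Let n ≥ 3, let A : ℤ → ℝ² be n-periodic (A_{i+n} = A_i) with A_1, …, A_n lying on a circle in anticlockwise order, let 2 ≤ m ≤ n−1, and let q, r be integers with 1 ≤ q, r ≤ n such that the points A_q, A_{q+1}, …, A_{q+m−2}, A_r, A_{r+1} are pairwise distinct (indices modulo n). Then S_{q,r,r+1} · ∏_{i=1}^{m−2} x_{q+i,r+1} = Σ_{j=0}^{m−3} S_{q+j,q+j+1,r+1} · x_{r,r+1} · ∏_{i ∈ {0,…,m−2}, i ≠ j, i ≠ j+1} x_{q+i,r+1} + S_{q+m−2,r,r+1} · ∏_{i=0}^{m−3} x_{q+i,r+1}. -/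
open Finset

theorem aux3 (O P Q B T : ℝ × ℝ) (R : ℝ) (hP : sqDist O P = R^2) (hQ : sqDist O Q = R^2)
    (hB : sqDist O B = R^2) (hT : sqDist O T = R^2) :
    S4 P B T * sqDist Q T = S4 P Q T * sqDist B T + S4 Q B T * sqDist P T := by
  simp only [sqDist, S4] at *
  linear_combination
    2 * ((P.1-T.1)*(B.2-T.2) - (P.2-T.2)*(B.1-T.1)) * (hQ - hT)
    - 2 * ((P.1-T.1)*(Q.2-T.2) - (P.2-T.2)*(Q.1-T.1)) * (hB - hT)
    - 2 * ((Q.1-T.1)*(B.2-T.2) - (Q.2-T.2)*(B.1-T.1)) * (hP - hT)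

theorem auxInd (s u x : ℤ → ℝ) (b : ℝ) (h : ∀ j, s j * x (j+1) = u j * b + s (j+1) * x j)
    (k : ℤ) (hk : 0 ≤ k) :
    s 0 * ∏ i ∈ Finset.Icc 1 k, x i =
      (∑ j ∈ Finset.Icc 0 (k-1), u j * b *
          ∏ i ∈ (Finset.Icc 0 k).filter (fun i => i ≠ j ∧ i ≠ j + 1), x i) +
      s k * ∏ i ∈ Finset.Icc 0 (k-1), x i := by
  induction k, hk using Int.leInduction with
  | base => simp
  | succ k hk ih =>
    have e1 : Finset.Icc 1 (k+1) = insert (k+1) (Finset.Icc 1 k) := by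
      ext; simp; omega
    have e2 : Finset.Icc 0 (k+1-1) = insert k (Finset.Icc 0 (k-1)) := by
      ext; simp; omega
    have e3 : (Finset.Icc 0 (k+1)).filter (fun i => i ≠ k ∧ i ≠ k + 1) = Finset.Icc 0 (k-1) := by
      ext; simp; omega
    have e4 : ∀ j ∈ Finset.Icc 0 (k-1), u j * b *
          ∏ i ∈ (Finset.Icc 0 (k+1)).filter (fun i => i ≠ j ∧ i ≠ j + 1), x i =
          x (k+1) * (u j * b *
          ∏ i ∈ (Finset.Icc 0 k).filter (fun i => i ≠ j ∧ i ≠ j + 1), x i) := by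
      intro j hj
      rw [Finset.mem_Icc] at hj
      have : (Finset.Icc 0 (k+1)).filter (fun i => i ≠ j ∧ i ≠ j + 1) =
          insert (k+1) ((Finset.Icc 0 k).filter (fun i => i ≠ j ∧ i ≠ j + 1)) := by
        ext; simp; omega
      rw [this, Finset.prod_insert (by simp)]
      ring
    rw [e1, e2, Finset.prod_insert (by simp), Finset.prod_insert (by simp),
      Finset.sum_insert (by simp), e3, Finset.sum_congr rfl e4, ← Finset.mul_sum]
    linear_combination x (k+1) * ih + (∏ i ∈ Finset.Icc 0 (k-1), x i) * h k

theorem stmt3 (n : ℤ) (hn : 3 ≤ n) (A : ℤ → ℝ × ℝ)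
    (hper : ∀ i, A (i + n) = A i)
    (hcirc : Anticlockwise A 1 n)
    (m : ℤ) (hm1 : 2 ≤ m) (hm2 : m ≤ n - 1)
    (q r : ℤ) (hq : 1 ≤ q ∧ q ≤ n) (hr : 1 ≤ r ∧ r ≤ n)
    -- the points A_q, A_{q+1}, …, A_{q+m-2}, A_r, A_{r+1} are pairwise distinct
    (hdist1 : ∀ i j, 0 ≤ i → i ≤ m - 2 → 0 ≤ j → j ≤ m - 2 → i ≠ j → A (q + i) ≠ A (q + j))
    (hdist2 : ∀ i, 0 ≤ i → i ≤ m - 2 → A (q + i) ≠ A r ∧ A (q + i) ≠ A (r + 1))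
    (hdist3 : A r ≠ A (r + 1)) :
    S4 (A q) (A r) (A (r+1)) * ∏ i ∈ Finset.Icc 1 (m-2), sqDist (A (q+i)) (A (r+1)) =
      (∑ j ∈ Finset.Icc 0 (m-3),
        S4 (A (q+j)) (A (q+j+1)) (A (r+1)) * sqDist (A r) (A (r+1)) *
          ∏ i ∈ (Finset.Icc 0 (m-2)).filter (fun i => i ≠ j ∧ i ≠ j + 1),
            sqDist (A (q+i)) (A (r+1))) +
      S4 (A (q+m-2)) (A r) (A (r+1)) * ∏ i ∈ Finset.Icc 0 (m-3), sqDist (A (q+i)) (A (r+1)) := by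
  obtain ⟨O, R, θ, hR, -, -, hA⟩ := hcirc
  have hc : ∀ i, sqDist O (A i) = R^2 := by
    intro i
    have hp : Function.Periodic A n := hper
    have h1 : A i = A (1 + (i-1) % n) := by
      have h2 := hp.int_mul ((i-1)/n) (1 + (i-1) % n)
      rw [← h2]
      congr 1
      have := Int.emod_add_mul_ediv (i-1) n
      simp only [Int.cast_id]
      linarith
    have h3 := Int.emod_nonneg (i-1) (show n ≠ 0 by omega)
    have h4 := Int.emod_lt_of_pos (i-1) (show 0 < n by omega)
    rw [h1, hA _ (by omega) (by omega)]
    simp only [sqDist]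
    linear_combination R^2 * Real.sin_sq_add_cos_sq (θ (1 + (i-1) % n))
  have key := auxInd (fun j => S4 (A (q+j)) (A r) (A (r+1)))
    (fun j => S4 (A (q+j)) (A (q+j+1)) (A (r+1))) (fun j => sqDist (A (q+j)) (A (r+1)))
    (sqDist (A r) (A (r+1)))
    (fun j => by
      simp only [← add_assoc]
      exact aux3 O _ _ _ _ R (hc _) (hc _) (hc _) (hc _)) (m-2) (by omega)
  have e1 : m - 2 - 1 = m - 3 := by ring
  have e2 : q + (m - 2) = q + m - 2 := by ring
  simp only [e1, e2, add_zero] at key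
  exact key
end

section
/- Let n be a positive integer divisible by 4 with n ≥ 8, and let A_1, …, A_n be distinct points in ℝ² lying on a common circle. Then the (n/2) × (n/2) matrix M whose (i,j)-entry (for 1 ≤ i, j ≤ n/2) is the squared distance M_{ij} := x_{2i, 2j−1} has determinant zero: det M = 0. -/
theorem stmt4 (n : ℕ) (hn4 : 4 ∣ n) (hn : 8 ≤ n) (A : ℕ → ℝ × ℝ)
    (hdist : ∀ i j, 1 ≤ i → i ≤ n → 1 ≤ j → j ≤ n → i ≠ j → A i ≠ A j)
    (hcirc : ∃ (O : ℝ × ℝ) (R : ℝ), 0 < R ∧ ∀ i, 1 ≤ i → i ≤ n → sqDist O (A i) = R ^ 2) :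
    Matrix.det
      (Matrix.of fun i j : Fin (n / 2) =>
        sqDist (A (2 * (i.1 + 1))) (A (2 * j.1 + 1))) = 0 := by
  obtain ⟨O, R, hR, hO⟩ := hcirc
  by_contra hdet
  set M : Matrix (Fin (n / 2)) (Fin (n / 2)) ℝ := Matrix.of fun i j : Fin (n / 2) =>
        sqDist (A (2 * (i.1 + 1))) (A (2 * j.1 + 1)) with hM
  let U : Matrix (Fin (n / 2)) (Fin 3) ℝ := Matrix.of fun i =>
    ![2 * R ^ 2, (A (2 * (i.1 + 1))).1 - O.1, (A (2 * (i.1 + 1))).2 - O.2]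
  let V : Matrix (Fin 3) (Fin (n / 2)) ℝ := Matrix.of fun k j =>
    ![1, -2 * ((A (2 * j.1 + 1)).1 - O.1), -2 * ((A (2 * j.1 + 1)).2 - O.2)] k
  have hUV : M = U * V := by
    ext i j
    have hi := i.2
    have hj := j.2
    have h1 := hO (2 * (i.1 + 1)) (by omega) (by omega)
    have h2 := hO (2 * j.1 + 1) (by omega) (by omega)
    simp only [hM, U, V, Matrix.mul_apply, Fin.sum_univ_three, Matrix.of_apply, sqDist] at h1 h2 ⊢
    simp
    linear_combination h1 + h2
  have hu : IsUnit M := (Matrix.isUnit_iff_isUnit_det M).2 (isUnit_iff_ne_zero.2 hdet)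
  have h1 := Matrix.rank_of_isUnit M hu
  have h2 : M.rank ≤ U.rank := by rw [hUV]; exact Matrix.rank_mul_le_left U V
  have h3 := U.rank_le_card_width
  simp only [Fintype.card_fin] at h1 h3
  omega
end

section
/- Let n > 4 be an even integer and let A_1, …, A_n be points in ℝ² lying on a circle in anticlockwise order. Adopt the conventions S_{ijk} = 1 and x_{ij} = 1 whenever one of the indices is ≤ 0, x_{ij}^p = 1 whenever the integer exponent p is negative, and empty products equal 1. For 1 ≤ m ≤ n set a := 1 if m ∈ {1,3} and a := 0 otherwise; b := 1 if m ∈ {1,3,5} and b := 0 otherwise; c := 0 if n = 6 and c := 1 if n ≥ 8. Define x(m) := x_{12}·x_{34}^c·∏_{l even, m ≤ l ≤ n−2} x_{l,l+1}^{(l−2)/2} · ∏_{l odd, 5 ≤ l ≤ m−1} x_{l,l+1}^{(l−3)/2} if m is even; x(m) := x_{12}^a·∏_{l even, m−1 ≤ l ≤ n−2} x_{l,l+1}^{(l−2)/2} · ∏_{l odd, 5 ≤ l ≤ m} x_{l,l+1}^{(l−3)/2} if m is odd and n = 6; x(m) := x_{12}^a·x_{34}^b·x_{m−2,m−1}^{(m−5)/2}·x_{m,m+1}^{(m−3)/2}·∏_{l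 even, m−1 ≤ l ≤ n−2} x_{l,l+1}^{(l−2)/2}·∏_{l odd, 5 ≤ l ≤ m−4} x_{l,l+1}^{(l−5)/2} if m is odd and n > 6. Define S(m) := (∏_{k=1}^{m−1} (∏_{l even, k+1 ≤ l ≤ m−2} S_{k,l,l+1} · ∏_{l odd, m+1 ≤ l ≤ n−1} S_{k,l,l+1})) · (∏_{k=m}^{n−3} ∏_{l odd, k+2 ≤ l ≤ n−1} S_{k+1,l,l+1}) if m is even; S(m) := S_{m−2,m−1,m+1} · (∏_{l odd, m+2 ≤ l ≤ n−1} S_{m−1,l,l+1}·S_{m−2,l,l+1}·S_{m−3,l,l+1}) · (∏_{k=m}^{n−3} ∏_{l odd, k+2 ≤ l ≤ n−1} S_{k+1,l,l+1}) · (∏_{k=1}^{m−4} ((S_{k,k+1,k+2}·S_{k,k+1,m−1}·S_{k,k+1,m+1})^{(k mod 2)} · ∏_{l even, k+2 ≤ l ≤ m−2} S_{k,l,l+1} · ∏_{l odd, m+2 ≤ l ≤ n−1} S_{k,l,l+1})) if m is odd. Then Σ_{m=1}^{n} (−1)^{m+1} · x(m) · S(m) = 0. -/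
open Finset

/-- Squared distance `x_{ij}` with the convention `x_{ij} = 1` if some index is `≤ 0`. -/
noncomputable def xI (A : ℤ → ℝ × ℝ) (i j : ℤ) : ℝ :=
  if i ≤ 0 ∨ j ≤ 0 then 1 else sqDist (A i) (A j)

/-- Signed-area entry `S_{ijk}` with the convention `S_{ijk} = 1` if some index is `≤ 0`. -/
noncomputable def SI (A : ℤ → ℝ × ℝ) (i j k : ℤ) : ℝ :=
  if i ≤ 0 ∨ j ≤ 0 ∨ k ≤ 0 then 1 else S4 (A i) (A j) (A k)

/-- The monomial `x(m)` of Theorem 3.1.  Note that `v ^ p.toNat = 1` whenever `p < 0`,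
implementing the convention `x_{i,j}^p = 1` for `p < 0`. -/
noncomputable def xMon (A : ℤ → ℝ × ℝ) (n m : ℤ) : ℝ :=
  if Even m then
    xI A 1 2 * (xI A 3 4) ^ (if n = 6 then 0 else 1) *
      (∏ l ∈ (Finset.Icc m (n-2)).filter (fun l => Even l),
        (xI A l (l+1)) ^ (((l-2)/2).toNat)) *
      (∏ l ∈ (Finset.Icc 5 (m-1)).filter (fun l => Odd l),
        (xI A l (l+1)) ^ (((l-3)/2).toNat))
  else if n = 6 then
    (xI A 1 2) ^ (if m = 1 ∨ m = 3 then 1 else 0) *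
      (∏ l ∈ (Finset.Icc (m-1) (n-2)).filter (fun l => Even l),
        (xI A l (l+1)) ^ (((l-2)/2).toNat)) *
      (∏ l ∈ (Finset.Icc 5 m).filter (fun l => Odd l),
        (xI A l (l+1)) ^ (((l-3)/2).toNat))
  else
    (xI A 1 2) ^ (if m = 1 ∨ m = 3 then 1 else 0) *
    (xI A 3 4) ^ (if m = 1 ∨ m = 3 ∨ m = 5 then 1 else 0) *
    (xI A (m-2) (m-1)) ^ (((m-5)/2).toNat) *
    (xI A m (m+1)) ^ (((m-3)/2).toNat) *
      (∏ l ∈ (Finset.Icc (m-1) (n-2)).filter (fun l => Even l),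
        (xI A l (l+1)) ^ (((l-2)/2).toNat)) *
      (∏ l ∈ (Finset.Icc 5 (m-4)).filter (fun l => Odd l),
        (xI A l (l+1)) ^ (((l-5)/2).toNat))

/-- The monomial `S(m)` of Theorem 3.1. -/
noncomputable def SMon (A : ℤ → ℝ × ℝ) (n m : ℤ) : ℝ :=
  if Even m then
    (∏ k ∈ Finset.Icc 1 (m-1),
      ((∏ l ∈ (Finset.Icc (k+1) (m-2)).filter (fun l => Even l), SI A k l (l+1)) *
       (∏ l ∈ (Finset.Icc (m+1) (n-1)).filter (fun l => Odd l), SI A k l (l+1)))) *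
    (∏ k ∈ Finset.Icc m (n-3),
      ∏ l ∈ (Finset.Icc (k+2) (n-1)).filter (fun l => Odd l), SI A (k+1) l (l+1))
  else
    SI A (m-2) (m-1) (m+1) *
    (∏ l ∈ (Finset.Icc (m+2) (n-1)).filter (fun l => Odd l),
      SI A (m-1) l (l+1) * SI A (m-2) l (l+1) * SI A (m-3) l (l+1)) *
    (∏ k ∈ Finset.Icc m (n-3),
      ∏ l ∈ (Finset.Icc (k+2) (n-1)).filter (fun l => Odd l), SI A (k+1) l (l+1)) *
    (∏ k ∈ Finset.Icc 1 (m-4),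
      ((SI A k (k+1) (k+2) * SI A k (k+1) (m-1) * SI A k (k+1) (m+1)) ^ ((k % 2).toNat) *
       (∏ l ∈ (Finset.Icc (k+2) (m-2)).filter (fun l => Even l), SI A k l (l+1)) *
       (∏ l ∈ (Finset.Icc (m+2) (n-1)).filter (fun l => Odd l), SI A k l (l+1))))

lemma pEven (p q : ℕ) (a b : ℤ) (f : ℤ → ℝ) (ha : 2*(p:ℤ)+1 ≤ a) (ha' : a ≤ 2*p+2)
    (hb : 2*(q:ℤ) ≤ b) (hb' : b ≤ 2*q+1) :
    ∏ l ∈ (Finset.Icc a b).filter (fun l => Even l), f l = ∏ i ∈ Finset.Ico p q, f (2*(i:ℤ)+2) := by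
  symm
  refine Finset.prod_bij (fun i _ => 2*(i:ℤ)+2) ?_ ?_ ?_ ?_
  · intro i hi
    simp only [Finset.mem_Ico, Finset.mem_filter, Finset.mem_Icc, Int.even_iff] at *
    omega
  · intro i _ j _ h
    omega
  · intro l hl
    simp only [Finset.mem_filter, Finset.mem_Icc, Int.even_iff] at hl
    refine ⟨((l-2)/2).toNat, ?_, ?_⟩
    · simp only [Finset.mem_Ico]; omega
    · omega
  · intros; rfl

lemma pOdd (p q : ℕ) (a b : ℤ) (f : ℤ → ℝ) (ha : 2*(p:ℤ)+2 ≤ a) (ha' : a ≤ 2*p+3)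
    (hb : 2*(q:ℤ)+1 ≤ b) (hb' : b ≤ 2*q+2) :
    ∏ l ∈ (Finset.Icc a b).filter (fun l => Odd l), f l = ∏ i ∈ Finset.Ico p q, f (2*(i:ℤ)+3) := by
  symm
  refine Finset.prod_bij (fun i _ => 2*(i:ℤ)+3) ?_ ?_ ?_ ?_
  · intro i hi
    simp only [Finset.mem_Ico, Finset.mem_filter, Finset.mem_Icc, Int.odd_iff] at *
    omega
  · intro i _ j _ h
    omega
  · intro l hl
    simp only [Finset.mem_filter, Finset.mem_Icc, Int.odd_iff] at hl
    refine ⟨((l-3)/2).toNat, ?_, ?_⟩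
    · simp only [Finset.mem_Ico]; omega
    · omega
  · intros; rfl

lemma pOdd1 (q : ℕ) (b : ℤ) (f : ℤ → ℝ) (hb : 2*(q:ℤ)-1 ≤ b) (hb' : b ≤ 2*q) :
    ∏ l ∈ (Finset.Icc 1 b).filter (fun l => Odd l), f l = ∏ i ∈ Finset.range q, f (2*(i:ℤ)+1) := by
  symm
  refine Finset.prod_bij (fun i _ => 2*(i:ℤ)+1) ?_ ?_ ?_ ?_
  · intro i hi
    simp only [Finset.mem_range, Finset.mem_filter, Finset.mem_Icc, Int.odd_iff] at *
    omega
  · intro i _ j _ h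
    omega
  · intro l hl
    simp only [Finset.mem_filter, Finset.mem_Icc, Int.odd_iff] at hl
    refine ⟨((l-1)/2).toNat, ?_, ?_⟩
    · simp only [Finset.mem_range]; omega
    · omega
  · intros; rfl

/-- enumeration of the positive integers with `m` removed. -/
def bI (m : ℤ) (k : ℕ) : ℤ := if (k:ℤ) + 1 < m then k + 1 else k + 2

lemma Icc_top (a b : ℤ) (h : a ≤ b + 1) (f : ℤ → ℝ) :
    ∏ k ∈ Finset.Icc a (b+1), f k = (∏ k ∈ Finset.Icc a b, f k) * f (b+1) := by
  have : Finset.Icc a (b+1) = insert (b+1) (Finset.Icc a b) := by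
    ext x; simp only [Finset.mem_Icc, Finset.mem_insert]; omega
  rw [this, Finset.prod_insert (by simp), mul_comm]

lemma bprod1 (m : ℤ) (f : ℤ → ℝ) (L : ℕ) (h : (L:ℤ) < m) :
    ∏ j ∈ Finset.range L, f (bI m j) = ∏ k ∈ Finset.Icc (1:ℤ) L, f k := by
  induction L with
  | zero => simp
  | succ L ih =>
    push_cast at *
    rw [Finset.prod_range_succ, ih (by omega), Icc_top _ _ (by omega)]
    simp [bI, h]

lemma bprod2 (m : ℤ) (f : ℤ → ℝ) (hm : 1 ≤ m) (L : ℕ) (h : m ≤ L + 1) :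
    ∏ j ∈ Finset.range L, f (bI m j) =
      (∏ k ∈ Finset.Icc (1:ℤ) (m-1), f k) * ∏ k ∈ Finset.Icc (m+1) ((L:ℤ)+1), f k := by
  induction L with
  | zero => 
    have : m = 1 := by push_cast at h; omega
    subst this; simp
  | succ L ih =>
    push_cast at *
    rcases eq_or_lt_of_le h with h | h
    · rw [bprod1 _ _ _ (by push_cast; omega)]
      subst h
      simp
    · rw [Finset.prod_range_succ, ih (by omega), Icc_top (m+1) ((L:ℤ)+1) (by omega), mul_assoc]
      congr 3
      unfold bI; rw [if_neg (by omega)]; ring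

lemma coeffs (q : ℕ) : ∃ c : ℕ → ℝ, ∀ u v : ℝ,
    ∑ j ∈ Finset.range (2*q+1), c j * (u^j * v^(2*q-j)) = (u^2+v^2)^q := by
  refine ⟨fun j => if Even j then (q.choose (j/2) : ℝ) else 0, fun u v => ?_⟩
  rw [add_pow]
  symm
  refine Finset.sum_of_injOn (fun k => 2*k) ?_ ?_ ?_ ?_
  · intro a _ b _ h; simp only at h; omega
  · intro a ha; simp at *; omega
  · intro j hj hj'
    beta_reduce
    rw [if_neg, zero_mul]
    rintro ⟨k, rfl⟩
    apply hj'
    simp at *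
    exact ⟨k, by omega, by omega⟩
  · intro k hk
    simp only [Finset.mem_range] at hk
    have : 2*q - 2*k = 2*(q-k) := by omega
    simp only [even_two_mul, if_true, this, pow_mul]
    rw [Nat.mul_div_cancel_left _ (by norm_num)]
    ring

/-- Vandermonde type product over the first `M` values of `b`. -/
def Vp (s : ℤ → ℤ → ℝ) (b : ℕ → ℤ) (M : ℕ) : ℝ :=
  ∏ j ∈ Finset.range M, ∏ k ∈ Finset.range j, s (b k) (b j)

lemma fin_Vp (s : ℤ → ℤ → ℝ) (b : ℕ → ℤ) (M : ℕ) :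
    ∏ i : Fin M, ∏ j ∈ Finset.Ioi i, s (b i) (b j) = Vp s b M := by
  rw [Finset.prod_comm' (s' := fun j => Finset.Iio j) (t' := Finset.univ) (by simp)]
  unfold Vp
  rw [← Fin.prod_univ_eq_prod_range (fun j => ∏ k ∈ Finset.range j, s (b k) (b j))]
  refine Finset.prod_congr rfl fun j _ => ?_
  refine Finset.prod_bij (fun i _ => (i:ℕ)) ?_ ?_ ?_ ?_
  · intro i hi; simpa using hi
  · intro i _ k _ h; exact Fin.ext h
  · intro k hk
    simp only [Finset.mem_range] at hk
    exact ⟨⟨k, by omega⟩, by simpa [Fin.lt_def] using hk, rfl⟩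
  · intros; rfl

lemma vander (q : ℕ) (v w : ℤ → ℝ) (D : ℝ) (hD : D ≠ 0) (hvw : ∀ i, v i^2 + w i^2 = D)
    (s : ℤ → ℤ → ℝ) (hs : ∀ i j, s i j = v j * w i - v i * w j) :
    ∑ i : Fin (2*q+1+1), (-1:ℝ)^(i:ℕ) * Vp s (bI ((i:ℤ)+1)) (2*q+1) = 0 := by
  obtain ⟨c, hc⟩ := coeffs q
  let V : Fin (2*q+1+1) → ℝ := fun i => v ((i:ℕ)+1)
  let W : Fin (2*q+1+1) → ℝ := fun i => w ((i:ℕ)+1)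
  let P : Matrix (Fin (2*q+1+1)) (Fin (2*q+1+1)) ℝ := Matrix.of fun i j =>
    Fin.cases (D^q) (fun j : Fin (2*q+1) => V i^(j:ℕ) * W i^(2*q-j)) j
  have h0 : P.det = 0 := by
    rw [← Matrix.exists_mulVec_eq_zero_iff]
    refine ⟨Fin.cons 1 (fun j => - c j), ?_, ?_⟩
    · intro h
      have := congrFun h 0
      simp at this
    · ext i
      simp only [Matrix.mulVec, dotProduct, Pi.zero_apply]
      rw [Fin.sum_univ_succ]
      simp only [P, Matrix.of_apply, Fin.cases_zero, Fin.cases_succ, Fin.cons_zero, Fin.cons_succ]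
      have := hc (V i) (W i)
      rw [← Fin.sum_univ_eq_sum_range (fun j => c j * (V i^j * W i^(2*q-j)))] at this
      rw [hvw] at this
      rw [← this]
      simp only [mul_one, mul_neg, Finset.sum_neg_distrib]
      rw [← sub_eq_add_neg, sub_eq_zero]
      exact Finset.sum_congr rfl fun j _ => mul_comm _ _
  rw [Matrix.det_succ_column_zero] at h0
  have key : ∀ i : Fin (2*q+1+1), (P.submatrix i.succAbove Fin.succ).det
      = Vp s (bI ((i:ℤ)+1)) (2*q+1) := by
    intro i
    have : P.submatrix i.succAbove Fin.succ =
        Matrix.projVandermonde (fun k => V (i.succAbove k)) (fun k => W (i.succAbove k)) := by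
      ext a b
      simp only [P, Matrix.submatrix_apply, Matrix.of_apply, Fin.cases_succ,
        Matrix.projVandermonde_apply, Fin.val_rev]
      congr 2
      omega
    rw [this, Matrix.det_projVandermonde, ← fin_Vp]
    have hb : ∀ k : Fin (2*q+1), (((i.succAbove k : Fin _) : ℕ) : ℤ) + 1 = bI ((i:ℤ)+1) k := by
      intro k
      unfold bI
      by_cases h : (k:ℕ) < (i:ℕ)
      · rw [Fin.succAbove_of_castSucc_lt _ _ (by simpa [Fin.lt_def] using h), if_pos (by omega)]
        simp
      · rw [Fin.succAbove_of_le_castSucc _ _ (by simpa [Fin.le_def] using h), if_neg (by omega)]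
        simp; ring
    refine Finset.prod_congr rfl fun a _ => Finset.prod_congr rfl fun b _ => ?_
    rw [hs, ← hb, ← hb]
  simp only [key] at h0
  have hP : ∀ i, P i 0 = D^q := fun i => rfl
  simp only [hP] at h0
  have : D^q * ∑ i : Fin (2*q+1+1), (-1:ℝ)^(i:ℕ) * Vp s (bI ((i:ℤ)+1)) (2*q+1) = 0 := by
    rw [Finset.mul_sum, ← h0]
    exact Finset.sum_congr rfl fun j _ => by ring
  exact (mul_eq_zero.1 this).resolve_left (pow_ne_zero _ hD)

def Vc (s : ℤ → ℤ → ℝ) (b : ℕ → ℤ) (i : ℕ) : ℝ :=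
  s (b (2*i+1)) (b (2*i+2)) *
    ∏ k ∈ Finset.range (2*i+1), (s (b k) (b (2*i+1)) * s (b k) (b (2*i+2)))

lemma Vp_cols (s : ℤ → ℤ → ℝ) (b : ℕ → ℤ) (q : ℕ) :
    Vp s b (2*q+1) = ∏ i ∈ Finset.range q, Vc s b i := by
  induction q with
  | zero => simp [Vp]
  | succ q ih =>
    rw [Finset.prod_range_succ, ← ih]
    have : 2*(q+1)+1 = 2*q+1+1+1 := by ring
    rw [this]
    unfold Vp Vc
    rw [Finset.prod_range_succ _ (2*q+1+1), Finset.prod_range_succ _ (2*q+1),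
      Finset.prod_range_succ (fun k => s (b k) (b (2*q+1+1))), Finset.prod_mul_distrib]
    ring

lemma colS (S : ℤ → ℤ → ℤ → ℝ) (s : ℤ → ℤ → ℝ) (b : ℕ → ℤ) (r : ℝ) (i : ℕ)
    (h : ∀ k < 2*i+1, S (b k) (b (2*i+1)) (b (2*i+2)) = r * (s (b k) (b (2*i+1)) *
      s (b k) (b (2*i+2)) * s (b (2*i+1)) (b (2*i+2)))) :
    ∏ k ∈ Finset.range (2*i+1), S (b k) (b (2*i+1)) (b (2*i+2)) =
      r^(2*i+1) * (s (b (2*i+1)) (b (2*i+2))^2)^i * Vc s b i := by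
  rw [Finset.prod_congr rfl (fun k hk => h k (Finset.mem_range.1 hk))]
  unfold Vc
  rw [Finset.prod_mul_distrib, Finset.prod_mul_distrib]
  simp only [Finset.prod_const, Finset.card_range]
  rw [← pow_mul, pow_succ (s (b (2*i+1)) (b (2*i+2)))]
  ring

lemma tailS (F : ℤ → ℤ → ℝ) (n m a : ℤ) (ha : a ≤ m + 2) :
    ∏ k ∈ Finset.Icc m (n-3), ∏ l ∈ (Finset.Icc (k+2) (n-1)).filter (fun l => Odd l), F (k+1) l
    = ∏ l ∈ (Finset.Icc a (n-1)).filter (fun l => Odd l), ∏ k ∈ Finset.Icc (m+1) (l-1), F k l := by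
  rw [Finset.prod_comm' (s' := fun l => Finset.Icc m (l-2))
    (t' := (Finset.Icc a (n-1)).filter (fun l => Odd l))]
  · refine Finset.prod_congr rfl fun l _ => ?_
    refine Finset.prod_bij (fun k _ => k+1) ?_ ?_ ?_ ?_
    · intro k hk; simp only [Finset.mem_Icc] at *; omega
    · intro k _ j _ h; omega
    · intro k hk
      simp only [Finset.mem_Icc] at hk
      exact ⟨k-1, by simp only [Finset.mem_Icc]; omega, by ring⟩
    · intros; rfl
  · intro k l
    simp only [Finset.mem_Icc, Finset.mem_filter, Int.odd_iff]
    omega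

lemma Ico_one_pow (f : ℕ → ℝ) (p : ℕ) :
    ∏ i ∈ Finset.Ico 1 p, f i ^ i = ∏ i ∈ Finset.range p, f i ^ i := by
  rcases p with _ | p
  · simp
  · rw [Finset.range_eq_Ico, Finset.prod_eq_prod_Ico_succ_bot (by omega : 0 < p+1)]
    simp

noncomputable def CC (A : ℤ → ℝ × ℝ) (r : ℝ) (q : ℕ) : ℝ :=
  xI A 1 2 * (xI A 3 4) ^ (if 2*(q:ℤ)+2 = 6 then 0 else 1) *
    ∏ i ∈ Finset.range q, ((xI A (2*i+2) (2*i+3))^i * (xI A (2*i+3) (2*i+4))^i * r^(2*i+1))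

lemma SMon_even (A : ℤ → ℝ × ℝ) (p q : ℕ) (hpq : p ≤ q) :
    SMon A (2*q+2) (2*p+2) =
      (∏ i ∈ Finset.range p, ∏ k ∈ Finset.range (2*i+1),
        SI A (bI (2*p+2) k) (bI (2*p+2) (2*i+1)) (bI (2*p+2) (2*i+2))) *
      (∏ i ∈ Finset.Ico p q, ∏ k ∈ Finset.range (2*i+1),
        SI A (bI (2*p+2) k) (bI (2*p+2) (2*i+1)) (bI (2*p+2) (2*i+2))) := by
  unfold SMon
  rw [if_pos ⟨p+1, by ring⟩, tailS (fun k l => SI A k l (l+1)) _ _ (2*p+3) (by omega),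
    Finset.prod_mul_distrib]
  rw [Finset.prod_comm' (s' := fun l => Finset.Icc 1 (l-1))
    (t' := (Finset.Icc 1 (2*(p:ℤ)+2-2)).filter (fun l => Even l))]
  swap
  · intro k l
    simp only [Finset.mem_Icc, Finset.mem_filter, Int.even_iff]
    omega
  rw [Finset.prod_comm (s := Finset.Icc 1 (2*(p:ℤ)+2-1))]
  rw [pEven 0 p _ _ _ (by norm_num) (by norm_num) (by omega) (by omega),
    pOdd p q _ _ _ (by omega) (by omega) (by omega) (by omega),
    pOdd p q _ _ _ (by omega) (by omega) (by omega) (by omega), mul_assoc,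
    ← Finset.prod_mul_distrib, ← Finset.range_eq_Ico]
  congr 1
  · refine Finset.prod_congr rfl fun i hi => ?_
    rw [Finset.mem_range] at hi
    rw [bprod1 _ (fun k => SI A k (bI (2*p+2) (2*i+1)) (bI (2*p+2) (2*i+2))) _ (by push_cast; omega)]
    unfold bI
    rw [if_pos (by push_cast; omega), if_pos (by push_cast; omega)]
    push_cast
    refine Finset.prod_congr (by congr 1 <;> ring) fun k _ => by congr 1 <;> ring
  · refine Finset.prod_congr rfl fun i hi => ?_
    rw [Finset.mem_Ico] at hi
    rw [bprod2 _ (fun k => SI A k (bI (2*p+2) (2*i+1)) (bI (2*p+2) (2*i+2))) (by omega) _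
      (by push_cast; omega)]
    unfold bI
    rw [if_neg (by push_cast; omega), if_neg (by push_cast; omega)]
    push_cast
    congr 1
    refine Finset.prod_congr (by congr 1; ring) fun k _ => by congr 1 <;> ring

lemma main_even (A : ℤ → ℝ × ℝ) (p q : ℕ) (hpq : p ≤ q) (s : ℤ → ℤ → ℝ) (r : ℝ)
    (hx : ∀ i, 1 ≤ i → i + 1 ≤ 2*(q:ℤ)+2 → xI A i (i+1) = s i (i+1)^2)
    (hS : ∀ i j k, 1 ≤ i → i < j → j < k → k ≤ 2*(q:ℤ)+2 →
      SI A i j k = r * (s i j * s i k * s j k)) :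
    xMon A (2*q+2) (2*p+2) * SMon A (2*q+2) (2*p+2) = CC A r q * Vp s (bI (2*p+2)) (2*q+1) := by
  rw [SMon_even A p q hpq]
  have hcol : ∀ i < q, ∏ k ∈ Finset.range (2*i+1),
        SI A (bI (2*p+2) k) (bI (2*p+2) (2*i+1)) (bI (2*p+2) (2*i+2)) =
        r^(2*i+1) * (s (bI (2*p+2) (2*i+1)) (bI (2*p+2) (2*i+2))^2)^i * Vc s (bI (2*p+2)) i := by
    intro i hi
    apply colS
    intro k hk
    apply hS <;> (unfold bI; push_cast; split_ifs <;> omega)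
  have h1 : ∀ i ∈ Finset.range p, ∏ k ∈ Finset.range (2*i+1),
        SI A (bI (2*p+2) k) (bI (2*p+2) (2*i+1)) (bI (2*p+2) (2*i+2)) =
        r^(2*i+1) * (xI A (2*i+2) (2*i+3))^i * Vc s (bI (2*p+2)) i := by
    intro i hi
    rw [Finset.mem_range] at hi
    have e1 : bI (2*p+2) (2*i+1) = 2*i+2 := by
      unfold bI; rw [if_pos (by push_cast; omega)]; push_cast; ring
    have e2 : bI (2*p+2) (2*i+2) = 2*i+2+1 := by
      unfold bI; rw [if_pos (by push_cast; omega)]; push_cast; ring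
    rw [hcol i (by omega), e1, e2, ← hx _ (by omega) (by omega)]
    congr 4
  have h2 : ∀ i ∈ Finset.Ico p q, ∏ k ∈ Finset.range (2*i+1),
        SI A (bI (2*p+2) k) (bI (2*p+2) (2*i+1)) (bI (2*p+2) (2*i+2)) =
        r^(2*i+1) * (xI A (2*i+3) (2*i+4))^i * Vc s (bI (2*p+2)) i := by
    intro i hi
    rw [Finset.mem_Ico] at hi
    have e1 : bI (2*p+2) (2*i+1) = 2*i+3 := by
      unfold bI; rw [if_neg (by push_cast; omega)]; push_cast; ring
    have e2 : bI (2*p+2) (2*i+2) = 2*i+3+1 := by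
      unfold bI; rw [if_neg (by push_cast; omega)]; push_cast; ring
    rw [hcol i (by omega), e1, e2, ← hx _ (by omega) (by omega)]
    congr 4
  rw [Finset.prod_congr rfl h1, Finset.prod_congr rfl h2, Vp_cols]
  unfold xMon CC
  rw [if_pos ⟨p+1, by ring⟩,
    pEven p q _ _ _ (by omega) (by omega) (by omega) (by omega),
    pOdd 1 p _ _ _ (by omega) (by omega) (by omega) (by omega)]
  have e3 : ∀ i : ℕ, ((2*(i:ℤ)+2-2)/2).toNat = i := by intro i; omega
  have e4 : ∀ i : ℕ, ((2*(i:ℤ)+3-3)/2).toNat = i := by intro i; omega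
  simp only [e3, e4]
  rw [Ico_one_pow (fun i => xI A (2*i+3) (2*i+3+1))]
  rw [← Finset.prod_range_mul_prod_Ico _ hpq, ← Finset.prod_range_mul_prod_Ico (Vc s _) hpq]
  have e5 : ∀ i : ℕ, (2*(i:ℤ)+2+1) = 2*i+3 := by intro i; ring
  have e6 : ∀ i : ℕ, (2*(i:ℤ)+3+1) = 2*i+4 := by intro i; ring
  simp only [e5, e6, Finset.prod_mul_distrib]
  ring

lemma xprod (X : ℤ → ℝ) (t : ℕ) :
    (∏ j ∈ Finset.range t, X (2*j+5)^j) * ∏ j ∈ Finset.range (t+2), X (2*j+1) =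
      X 1 * X 3 * ∏ j ∈ Finset.range (t+1), X (2*j+3)^j := by
  induction t with
  | zero => simp [Finset.prod_range_succ]
  | succ t ih =>
    rw [show t+1+2 = t+2+1 from rfl, Finset.prod_range_succ (fun j : ℕ => X (2*j+5)^j) t,
      Finset.prod_range_succ (fun j : ℕ => X (2*j+1)) (t+2),
      Finset.prod_range_succ (fun j : ℕ => X (2*j+3)^j) (t+1)]
    have e1 : (2*((t+2:ℕ):ℤ)+1) = 2*t+5 := by push_cast; ring
    have e2 : (2*((t+1:ℕ):ℤ)+3) = 2*t+5 := by push_cast; ring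
    rw [e1, e2, pow_succ]
    linear_combination (X (2*t+5)^t * X (2*t+5)) * ih

lemma xMon_odd (A : ℤ → ℝ × ℝ) (p q : ℕ) (hpq : p < q) (hq : 2 ≤ q) :
    xMon A (2*q+2) (2*p+3) * ∏ j ∈ Finset.range p, xI A (2*j+1) (2*j+2) =
      xI A 1 2 * (xI A 3 4) ^ (if 2*(q:ℤ)+2 = 6 then 0 else 1) *
      (∏ i ∈ Finset.Ico p q, (xI A (2*i+2) (2*i+3))^i) *
      ∏ i ∈ Finset.range (p+1), (xI A (2*i+3) (2*i+4))^i := by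
  have e3 : ∀ i : ℕ, ((2*(i:ℤ)+2-2)/2).toNat = i := by intro i; omega
  have e4 : ∀ i : ℕ, ((2*(i:ℤ)+3-3)/2).toNat = i := by intro i; omega
  have e5 : ∀ i : ℕ, (2*(i:ℤ)+2+1) = 2*i+3 := by intro i; ring
  have e6 : ∀ i : ℕ, (2*(i:ℤ)+3+1) = 2*i+4 := by intro i; ring
  have e7 : ∀ i : ℕ, (2*(i:ℤ)+1+1) = 2*i+2 := by intro i; ring
  unfold xMon
  rw [if_neg (by rw [Int.not_even_iff]; omega)]
  rw [pEven p q _ _ _ (by omega) (by omega) (by omega) (by omega)]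
  simp only [e3, e5, e6]
  by_cases h6 : 2*(q:ℤ)+2 = 6
  · rw [if_pos h6, if_pos h6]
    rw [pOdd 1 (p+1) _ _ _ (by omega) (by omega) (by push_cast; omega) (by push_cast; omega)]
    simp only [e4, e6]
    rw [Ico_one_pow (fun i => xI A (2*i+3) (2*i+4))]
    have : p = 0 ∨ p = 1 := by omega
    rcases this with rfl | rfl
    · simp
    · simp; ring
  · rw [if_neg h6, if_neg h6]
    rw [Finset.prod_range_succ _ p]
    rcases p with _ | _ | t
    · simp
    · simp; ring
    · rw [if_neg (by push_cast; omega), if_neg (by push_cast; omega)]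
      have hl : ∏ l ∈ (Finset.Icc 5 (2*((t+1+1:ℕ):ℤ)+3-4)).filter (fun l => Odd l),
          (xI A l (l+1)) ^ (((l-5)/2).toNat) =
          ∏ j ∈ Finset.range t, (xI A (2*j+5) (2*j+6))^j := by
        rw [pOdd 1 (t+1) _ _ _ (by omega) (by omega) (by push_cast; omega) (by push_cast; omega)]
        rw [Finset.range_eq_Ico, ← Finset.prod_Ico_add' _ 0 t 1]
        refine Finset.prod_congr rfl fun i _ => ?_
        have : ((2*((i+1:ℕ):ℤ)+3-5)/2).toNat = i := by omega
        rw [this]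
        congr 2 <;> (push_cast; ring)
      rw [hl]
      have := xprod (fun l => xI A l (l+1)) t
      have e8 : ∀ i : ℕ, (2*(i:ℤ)+5+1) = 2*i+6 := by intro i; ring
      simp only [e6, e7, e8] at this
      have e9 : ((2*((t+1+1:ℕ):ℤ)+3-5)/2).toNat = t+1 := by omega
      have e10 : (2*((t+1+1:ℕ):ℤ)+3-2) = 2*((t+1:ℕ):ℤ)+3 := by push_cast; ring
      have e11 : (2*((t+1+1:ℕ):ℤ)+3-1) = 2*((t+1:ℕ):ℤ)+4 := by push_cast; ring
      rw [e4, e9, e10, e11,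
        Finset.prod_range_succ (fun i : ℕ => (xI A (2*i+3) (2*i+4))^i) (t+1)]
      norm_num at this ⊢
      linear_combination ((xI A (2*((t:ℤ)+1)+3) (2*((t:ℤ)+1)+4))^(t+1) *
        (xI A (2*((t:ℤ)+1+1)+3) (2*((t:ℤ)+1+1)+4))^(t+1+1) *
         (∏ i ∈ Finset.Ico (t+1+1) q, (xI A (2*i+2) (2*i+3))^i)) * this

lemma SMon_odd (A : ℤ → ℝ × ℝ) (p q : ℕ) (hpq : p < q) :
    SMon A (2*q+2) (2*p+3) =
      (∏ i ∈ Finset.range p, ∏ k ∈ Finset.range (2*i+1),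
        SI A (bI (2*p+3) k) (bI (2*p+3) (2*i+1)) (bI (2*p+3) (2*i+2))) *
      (SI A (2*p+1) (2*p+2) (2*p+4) * ∏ j ∈ Finset.range p,
        (SI A (2*j+1) (2*j+2) (2*p+2) * SI A (2*j+1) (2*j+2) (2*p+4))) *
      (∏ i ∈ Finset.Ico (p+1) q, ∏ k ∈ Finset.range (2*i+1),
        SI A (bI (2*p+3) k) (bI (2*p+3) (2*i+1)) (bI (2*p+3) (2*i+2))) := by
  unfold SMon
  rw [if_neg (by rw [Int.not_even_iff]; omega),
    tailS (fun k l => SI A k l (l+1)) _ _ (2*p+5) (by omega),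
    Finset.prod_mul_distrib (s := Finset.Icc 1 (2*(p:ℤ)+3-4)),
    Finset.prod_mul_distrib (s := Finset.Icc 1 (2*(p:ℤ)+3-4))]
  rw [Finset.prod_comm' (s := Finset.Icc 1 (2*(p:ℤ)+3-4)) (s' := fun l => Finset.Icc 1 (l-2))
    (t' := (Finset.Icc 1 (2*(p:ℤ)+3-2)).filter (fun l => Even l))]
  swap
  · intro k l
    simp only [Finset.mem_Icc, Finset.mem_filter, Int.even_iff]
    omega
  rw [Finset.prod_comm (s := Finset.Icc 1 (2*(p:ℤ)+3-4))]
  have hk : ∏ k ∈ Finset.Icc 1 (2*(p:ℤ)+3-4), (SI A k (k+1) (k+2) * SI A k (k+1) (2*p+3-1) *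
      SI A k (k+1) (2*p+3+1)) ^ ((k % 2).toNat) =
      ∏ j ∈ Finset.range p, (SI A (2*j+1) (2*j+2) (2*j+3) * 
        (SI A (2*j+1) (2*j+2) (2*p+2) * SI A (2*j+1) (2*j+2) (2*p+4))) := by
    rw [← Finset.prod_filter_mul_prod_filter_not _ (fun k => Odd k)]
    rw [pOdd1 p _ _ (by omega) (by omega)]
    rw [Finset.prod_eq_one (s := Finset.filter (fun k => ¬ Odd k) _), mul_one]
    · refine Finset.prod_congr rfl fun j _ => ?_
      have : ((2*(j:ℤ)+1)%2).toNat = 1 := by omega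
      rw [this, pow_one, mul_assoc]
      congr 2 <;> first | ring | (congr 1 <;> ring)
    · intro k hk
      simp only [Finset.mem_filter, Int.not_odd_iff_even, Int.even_iff] at hk
      rw [hk.2]; simp
  rw [hk]
  rw [pEven 0 p _ _ _ (by norm_num) (by norm_num) (by omega) (by omega),
    pOdd (p+1) q _ _ _ (by push_cast; omega) (by push_cast; omega) (by omega) (by omega),
    pOdd (p+1) q _ _ _ (by push_cast; omega) (by push_cast; omega) (by omega) (by omega),
    pOdd (p+1) q _ _ _ (by push_cast; omega) (by push_cast; omega) (by omega) (by omega),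
    ← Finset.range_eq_Ico]
  have h1 : ∀ i ∈ Finset.range p, ∏ k ∈ Finset.range (2*i+1),
        SI A (bI (2*p+3) k) (bI (2*p+3) (2*i+1)) (bI (2*p+3) (2*i+2)) = 
        (∏ k ∈ Finset.Icc 1 (2*(i:ℤ)+2-2), SI A k (2*i+2) (2*i+2+1)) *
          SI A (2*i+1) (2*i+2) (2*i+3) := by
    intro i hi
    rw [Finset.mem_range] at hi
    rw [bprod1 _ (fun k => SI A k (bI (2*p+3) (2*i+1)) (bI (2*p+3) (2*i+2))) _ (by push_cast; omega)]
    unfold bI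
    rw [if_pos (by push_cast; omega), if_pos (by push_cast; omega)]
    push_cast
    rw [Icc_top _ _ (by omega)]
    have a1 : (2*(i:ℤ)+2-2) = 2*i := by ring
    have a2 : (2*(i:ℤ)+1+1) = 2*i+2 := by ring
    have a3 : (2*(i:ℤ)+2+1) = 2*i+3 := by ring
    rw [a1, a2, a3]
  have h2 : ∀ i ∈ Finset.Ico (p+1) q, ∏ k ∈ Finset.range (2*i+1),
        SI A (bI (2*p+3) k) (bI (2*p+3) (2*i+1)) (bI (2*p+3) (2*i+2)) = 
        (SI A (2*p+3-1) (2*i+3) (2*i+3+1) * SI A (2*p+3-2) (2*i+3) (2*i+3+1) *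
          SI A (2*p+3-3) (2*i+3) (2*i+3+1)) *
        (∏ k ∈ Finset.Icc (2*(p:ℤ)+3+1) (2*i+3-1), SI A k (2*i+3) (2*i+3+1)) *
        (∏ k ∈ Finset.Icc 1 (2*(p:ℤ)+3-4), SI A k (2*i+3) (2*i+3+1)) := by
    intro i hi
    rw [Finset.mem_Ico] at hi
    rw [bprod2 _ (fun k => SI A k (bI (2*p+3) (2*i+1)) (bI (2*p+3) (2*i+2))) (by omega) _
      (by push_cast; omega)]
    unfold bI
    rw [if_neg (by push_cast; omega), if_neg (by push_cast; omega)]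
    push_cast
    have a1 : (2*(i:ℤ)+3-1) = 2*i+1+1 := by ring
    have a2 : (2*(i:ℤ)+1+2) = 2*i+3 := by ring
    have a3 : (2*(i:ℤ)+2+2) = 2*i+3+1 := by ring
    have a4 : (2*(p:ℤ)+3-1) = 2*p-1+1+1+1 := by ring
    have a5 : (2*(p:ℤ)+3-2) = 2*p-1+1+1 := by ring
    have a6 : (2*(p:ℤ)+3-3) = 2*p-1+1 := by ring
    have a7 : (2*(p:ℤ)+3-4) = 2*p-1 := by ring
    rw [a1, a2, a3, a4, a5, a6, a7, Icc_top _ _ (by omega), Icc_top _ _ (by omega)]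
    have : ∏ k ∈ Finset.Icc 1 (2*(p:ℤ)-1+1), SI A k (2*i+3) (2*i+3+1) = 
      (∏ k ∈ Finset.Icc 1 (2*(p:ℤ)-1), SI A k (2*i+3) (2*i+3+1)) *
        SI A (2*p-1+1) (2*i+3) (2*i+3+1) := by
      rcases p with _ | p
      · simp [SI]
      · rw [Icc_top _ _ (by push_cast; omega)]
    rw [this]
    ring
  rw [Finset.prod_congr rfl h1, Finset.prod_congr rfl h2]
  have b1 : (2*(p:ℤ)+3-2) = 2*p+1 := by ring
  have b2 : (2*(p:ℤ)+3-1) = 2*p+2 := by ring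
  have b3 : (2*(p:ℤ)+3+1) = 2*p+4 := by ring
  simp only [Finset.prod_mul_distrib, b1, b2, b3]
  ring

lemma midcol (s : ℤ → ℤ → ℝ) (r : ℝ) (S : ℤ → ℤ → ℤ → ℝ) (c d n : ℤ) (p : ℕ)
    (hc : c = 2*p+2) (hcd : c < d) (hdn : d ≤ n)
    (hS : ∀ i j k, 1 ≤ i → i < j → j < k → k ≤ n →
      S i j k = r * (s i j * s i k * s j k)) :
    ∀ t ≤ p, ∏ j ∈ Finset.range t, (S (2*j+1) (2*j+2) c * S (2*j+1) (2*j+2) d) =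
      r^(2*t) * (∏ j ∈ Finset.range t, s (2*j+1) (2*j+2)^2) *
      ∏ k ∈ Finset.range (2*t), (s (k+1) c * s (k+1) d) := by
  intro t
  induction t with
  | zero => simp
  | succ t ih =>
    intro ht
    have : 2*(t+1) = 2*t+1+1 := by ring
    rw [this, Finset.prod_range_succ, ih (by omega), Finset.prod_range_succ,
      Finset.prod_range_succ _ (2*t+1), Finset.prod_range_succ _ (2*t),
      hS _ _ _ (by omega) (by omega) (by omega) (by omega),
      hS _ _ _ (by omega) (by omega) (by omega) (by omega)]
    push_cast
    have : (2*(t:ℤ)+1+1) = 2*t+2 := by ring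
    rw [this]
    ring

lemma main_odd (A : ℤ → ℝ × ℝ) (p q : ℕ) (hpq : p < q) (hq : 2 ≤ q) (s : ℤ → ℤ → ℝ) (r : ℝ)
    (hx : ∀ i, 1 ≤ i → i + 1 ≤ 2*(q:ℤ)+2 → xI A i (i+1) = s i (i+1)^2)
    (hS : ∀ i j k, 1 ≤ i → i < j → j < k → k ≤ 2*(q:ℤ)+2 →
      SI A i j k = r * (s i j * s i k * s j k)) :
    xMon A (2*q+2) (2*p+3) * SMon A (2*q+2) (2*p+3) = CC A r q * Vp s (bI (2*p+3)) (2*q+1) := by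
  rw [SMon_odd A p q hpq]
  have hcol : ∀ i < q, ∏ k ∈ Finset.range (2*i+1),
        SI A (bI (2*p+3) k) (bI (2*p+3) (2*i+1)) (bI (2*p+3) (2*i+2)) =
        r^(2*i+1) * (s (bI (2*p+3) (2*i+1)) (bI (2*p+3) (2*i+2))^2)^i * Vc s (bI (2*p+3)) i := by
    intro i hi
    apply colS
    intro k hk
    apply hS <;> (unfold bI; push_cast; split_ifs <;> omega)
  have h1 : ∀ i ∈ Finset.range p, ∏ k ∈ Finset.range (2*i+1),
        SI A (bI (2*p+3) k) (bI (2*p+3) (2*i+1)) (bI (2*p+3) (2*i+2)) =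
        r^(2*i+1) * (xI A (2*i+2) (2*i+3))^i * Vc s (bI (2*p+3)) i := by
    intro i hi
    rw [Finset.mem_range] at hi
    have e1 : bI (2*p+3) (2*i+1) = 2*i+2 := by
      unfold bI; rw [if_pos (by push_cast; omega)]; push_cast; ring
    have e2 : bI (2*p+3) (2*i+2) = 2*i+2+1 := by
      unfold bI; rw [if_pos (by push_cast; omega)]; push_cast; ring
    rw [hcol i (by omega), e1, e2, ← hx _ (by omega) (by omega)]
    congr 4
  have h2 : ∀ i ∈ Finset.Ico (p+1) q, ∏ k ∈ Finset.range (2*i+1),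
        SI A (bI (2*p+3) k) (bI (2*p+3) (2*i+1)) (bI (2*p+3) (2*i+2)) =
        r^(2*i+1) * (xI A (2*i+3) (2*i+4))^i * Vc s (bI (2*p+3)) i := by
    intro i hi
    rw [Finset.mem_Ico] at hi
    have e1 : bI (2*p+3) (2*i+1) = 2*i+3 := by
      unfold bI; rw [if_neg (by push_cast; omega)]; push_cast; ring
    have e2 : bI (2*p+3) (2*i+2) = 2*i+3+1 := by
      unfold bI; rw [if_neg (by push_cast; omega)]; push_cast; ring
    rw [hcol i (by omega), e1, e2, ← hx _ (by omega) (by omega)]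
    congr 4
  have h3 : SI A (2*p+1) (2*p+2) (2*p+4) * ∏ j ∈ Finset.range p,
        (SI A (2*j+1) (2*j+2) (2*p+2) * SI A (2*j+1) (2*j+2) (2*p+4)) =
      r^(2*p+1) * (∏ j ∈ Finset.range p, xI A (2*j+1) (2*j+2)) * Vc s (bI (2*p+3)) p := by
    have hX : ∏ j ∈ Finset.range p, xI A (2*j+1) (2*j+2) =
        ∏ j ∈ Finset.range p, s (2*j+1) (2*j+2)^2 := by
      refine Finset.prod_congr rfl fun j hj => ?_
      rw [Finset.mem_range] at hj
      have := hx (2*j+1) (by omega) (by omega)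
      have e : (2*(j:ℤ)+1+1) = 2*j+2 := by ring
      rwa [e] at this
    rw [midcol s r (SI A) (2*p+2) (2*p+4) (2*q+2) p rfl (by omega) (by omega) hS p le_rfl, hX,
      hS _ _ _ (by omega) (by omega) (by omega) (by omega)]
    unfold Vc
    have e1 : bI (2*p+3) (2*p+1) = 2*p+2 := by
      unfold bI; rw [if_pos (by push_cast; omega)]; push_cast; ring
    have e2 : bI (2*p+3) (2*p+2) = 2*p+4 := by
      unfold bI; rw [if_neg (by push_cast; omega)]; push_cast; ring
    have e3 : ∏ k ∈ Finset.range (2*p+1), (s (bI (2*p+3) k) (2*p+2) * s (bI (2*p+3) k) (2*p+4)) =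
        ∏ k ∈ Finset.range (2*p+1), (s (k+1) (2*p+2) * s (k+1) (2*p+4)) := by
      refine Finset.prod_congr rfl fun k hk => ?_
      rw [Finset.mem_range] at hk
      unfold bI; rw [if_pos (by omega)]
    rw [e1, e2, e3, Finset.prod_range_succ _ (2*p)]
    push_cast
    ring
  rw [Finset.prod_congr rfl h1, Finset.prod_congr rfl h2, h3, Vp_cols]
  have hxm := xMon_odd A p q hpq hq
  unfold CC
  rw [← Finset.prod_range_mul_prod_Ico (Vc s _) (by omega : p+1 ≤ q),
    Finset.prod_range_succ _ p]
  simp only [Finset.prod_mul_distrib]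
  rw [← Finset.prod_range_mul_prod_Ico (fun i : ℕ => (xI A (2*i+2) (2*i+3))^i) (by omega : p ≤ q),
    ← Finset.prod_range_mul_prod_Ico (fun i : ℕ => (xI A (2*i+3) (2*i+4))^i) (by omega : p+1 ≤ q),
    ← Finset.prod_range_mul_prod_Ico (fun i : ℕ => r^(2*i+1)) (by omega : p+1 ≤ q),
    Finset.prod_range_succ (fun i : ℕ => r^(2*i+1)) p]
  linear_combination ((∏ i ∈ Finset.range p, r^(2*i+1)) * r^(2*p+1) *
    (∏ i ∈ Finset.Ico (p+1) q, r^(2*i+1)) *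
    (∏ i ∈ Finset.range p, (xI A (2*i+2) (2*i+3))^i) *
    (∏ i ∈ Finset.Ico (p+1) q, (xI A (2*i+3) (2*i+4))^i) *
    (∏ i ∈ Finset.range p, Vc s (bI (2*p+3)) i) * Vc s (bI (2*p+3)) p *
    (∏ i ∈ Finset.Ico (p+1) q, Vc s (bI (2*p+3)) i)) * hxm

lemma main_one (A : ℤ → ℝ × ℝ) (q : ℕ) (s : ℤ → ℤ → ℝ) (r : ℝ)
    (hx : ∀ i, 1 ≤ i → i + 1 ≤ 2*(q:ℤ)+2 → xI A i (i+1) = s i (i+1)^2)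
    (hS : ∀ i j k, 1 ≤ i → i < j → j < k → k ≤ 2*(q:ℤ)+2 →
      SI A i j k = r * (s i j * s i k * s j k)) :
    xMon A (2*q+2) 1 * SMon A (2*q+2) 1 = CC A r q * Vp s (bI 1) (2*q+1) := by
  have e3 : ∀ i : ℕ, ((2*(i:ℤ)+2-2)/2).toNat = i := by intro i; omega
  have e5 : ∀ i : ℕ, (2*(i:ℤ)+2+1) = 2*i+3 := by intro i; ring
  have hX : xMon A (2*q+2) 1 = xI A 1 2 * (xI A 3 4) ^ (if 2*(q:ℤ)+2 = 6 then 0 else 1) *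
      ∏ i ∈ Finset.range q, (xI A (2*i+2) (2*i+3))^i := by
    have h0 : ∏ l ∈ (Finset.Icc (1-1) (2*(q:ℤ)+2-2)).filter (fun l => Even l),
        (xI A l (l+1)) ^ (((l-2)/2).toNat) = ∏ i ∈ Finset.range q, (xI A (2*i+2) (2*i+3))^i := by
      rw [← Finset.prod_subset (s₁ := (Finset.Icc 1 (2*(q:ℤ)+2-2)).filter (fun l => Even l))]
      · rw [pEven 0 q _ _ _ (by norm_num) (by norm_num) (by omega) (by omega)]
        simp only [e3, e5, ← Finset.range_eq_Ico]
      · intro l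
        simp only [Finset.mem_filter, Finset.mem_Icc]
        rintro ⟨⟨h1, h2⟩, h3⟩
        exact ⟨⟨by omega, h2⟩, h3⟩
      · intro l
        simp only [Finset.mem_filter, Finset.mem_Icc]
        intro h h'
        have : l = 0 := by
          by_contra h''
          exact h' ⟨⟨by omega, h.1.2⟩, h.2⟩
        subst this; simp
    unfold xMon
    rw [h0]
    split_ifs <;> simp_all
  have hSS : SMon A (2*q+2) 1 = ∏ i ∈ Finset.range q, ∏ k ∈ Finset.range (2*i+1),
        SI A (bI 1 k) (bI 1 (2*i+1)) (bI 1 (2*i+2)) := by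
    unfold SMon
    rw [if_neg (by decide), tailS (fun k l => SI A k l (l+1)) _ _ 3 (by omega),
      pOdd 0 q 3 _ _ (by norm_num) (by norm_num) (by omega) (by omega), ← Finset.range_eq_Ico]
    have : ∀ l, SI A (1-1) l (l+1) * SI A (1-2) l (l+1) * SI A (1-3) l (l+1) = 1 := by
      intro l; simp [SI]
    simp only [this]
    have h1 : SI A (1-2) (1-1) (1+1) = 1 := by simp [SI]
    rw [h1]
    simp only [Finset.prod_const_one, one_mul]
    rw [Finset.Icc_eq_empty (a := (1:ℤ)) (b := 1-4) (by norm_num), Finset.prod_empty, mul_one]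
    refine Finset.prod_congr rfl fun i _ => ?_
    rw [bprod2 _ (fun k => SI A k (bI 1 (2*i+1)) (bI 1 (2*i+2))) (by omega) _
      (by push_cast; omega)]
    unfold bI
    rw [if_neg (by push_cast; omega), if_neg (by push_cast; omega)]
    rw [Finset.Icc_eq_empty (a := (1:ℤ)) (b := 1-1) (by norm_num), Finset.prod_empty, one_mul]
    push_cast
    refine Finset.prod_congr (by congr 1; ring) fun k _ => by congr 1 <;> ring
  have h2 : ∀ i ∈ Finset.range q, ∏ k ∈ Finset.range (2*i+1),
        SI A (bI 1 k) (bI 1 (2*i+1)) (bI 1 (2*i+2)) =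
        r^(2*i+1) * (xI A (2*i+3) (2*i+4))^i * Vc s (bI 1) i := by
    intro i hi
    rw [Finset.mem_range] at hi
    have hcol : ∏ k ∈ Finset.range (2*i+1),
        SI A (bI 1 k) (bI 1 (2*i+1)) (bI 1 (2*i+2)) =
        r^(2*i+1) * (s (bI 1 (2*i+1)) (bI 1 (2*i+2))^2)^i * Vc s (bI 1) i := by
      apply colS
      intro k hk
      apply hS <;> (unfold bI; push_cast; split_ifs <;> omega)
    have e1 : bI 1 (2*i+1) = 2*i+3 := by
      unfold bI; rw [if_neg (by push_cast; omega)]; push_cast; ring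
    have e2 : bI 1 (2*i+2) = 2*i+3+1 := by
      unfold bI; rw [if_neg (by push_cast; omega)]; push_cast; ring
    rw [hcol, e1, e2, ← hx _ (by omega) (by omega)]
    congr 4
  rw [hX, hSS, Finset.prod_congr rfl h2, Vp_cols]
  unfold CC
  simp only [Finset.prod_mul_distrib]
  ring

theorem stmt5 (n : ℤ) (hn : 4 < n) (hne : Even n) (A : ℤ → ℝ × ℝ)
    (hcirc : Anticlockwise A 1 n) :
    ∑ m ∈ Finset.Icc 1 n, (-1 : ℝ) ^ ((m+1).toNat) * xMon A n m * SMon A n m = 0 := by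
  obtain ⟨O, R, θ, hR, -, -, hA⟩ := hcirc
  obtain ⟨q, hq, rfl⟩ : ∃ q : ℕ, 2 ≤ q ∧ n = 2*q+2 := by
    rw [Int.even_iff] at hne
    exact ⟨((n-2)/2).toNat, by omega, by omega⟩
  have hD : √(2*R)^2 = 2*R := Real.sq_sqrt (by positivity)
  let v : ℤ → ℝ := fun i => √(2*R) * Real.sin (θ i/2)
  let w : ℤ → ℝ := fun i => √(2*R) * Real.cos (θ i/2)
  let s : ℤ → ℤ → ℝ := fun i j => v j * w i - v i * w j
  have hs : ∀ i j, s i j = 2*R*(Real.sin (θ j/2) * Real.cos (θ i/2) -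
      Real.sin (θ i/2) * Real.cos (θ j/2)) := by
    intro i j; simp only [s, v, w]
    linear_combination (Real.sin (θ j/2) * Real.cos (θ i/2) -
      Real.sin (θ i/2) * Real.cos (θ j/2)) * hD
  have hvw : ∀ i, v i^2 + w i^2 = 2*R := by
    intro i
    simp only [v, w]
    linear_combination √(2*R)^2 * Real.sin_sq_add_cos_sq (θ i/2) + hD
  have hc : ∀ i, Real.cos (θ i) = 2*Real.cos (θ i/2)^2 - 1 := by
    intro i; rw [← Real.cos_two_mul]; congr 1; ring
  have hsn : ∀ i, Real.sin (θ i) = 2*Real.sin (θ i/2)*Real.cos (θ i/2) := by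
    intro i; rw [← Real.sin_two_mul]; congr 1; ring
  have hsq : ∀ i, Real.sin (θ i/2)^2 = 1 - Real.cos (θ i/2)^2 := by
    intro i; linarith [Real.sin_sq_add_cos_sq (θ i/2)]
  have hx : ∀ i, 1 ≤ i → i + 1 ≤ 2*(q:ℤ)+2 → xI A i (i+1) = s i (i+1)^2 := by
    intro i h1 h2
    unfold xI sqDist
    rw [if_neg (by omega), hA i h1 (by omega), hA (i+1) (by omega) h2, hs]
    simp only [hc, hsn]
    have a := hsq i
    have b := hsq (i+1)
    generalize Real.sin (θ i/2) = S1 at *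
    generalize Real.sin (θ (i+1)/2) = S2 at *
    generalize Real.cos (θ i/2) = C1 at *
    generalize Real.cos (θ (i+1)/2) = C2 at *
    grind
  have hS : ∀ i j k, 1 ≤ i → i < j → j < k → k ≤ 2*(q:ℤ)+2 →
      SI A i j k = R⁻¹ * (s i j * s i k * s j k) := by
    intro i j k h1 h2 h3 h4
    unfold SI S4
    rw [if_neg (by omega), hA i h1 (by omega), hA j (by omega) (by omega),
      hA k (by omega) (by omega), hs, hs, hs]
    simp only [hc, hsn]
    have a := hsq i
    have b := hsq j
    have c := hsq k
    generalize Real.sin (θ i/2) = S1 at *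
    generalize Real.sin (θ j/2) = S2 at *
    generalize Real.sin (θ k/2) = S3 at *
    generalize Real.cos (θ i/2) = C1 at *
    generalize Real.cos (θ j/2) = C2 at *
    generalize Real.cos (θ k/2) = C3 at *
    have hR' : R ≠ 0 := hR.ne'
    field_simp
    grind
  have hv := vander q v w (2*R) (by positivity) hvw s (fun _ _ => rfl)
  have hterm : ∀ m : ℤ, 1 ≤ m → m ≤ 2*q+2 →
      xMon A (2*q+2) m * SMon A (2*q+2) m = CC A R⁻¹ q * Vp s (bI m) (2*q+1) := by
    intro m h1 h2
    rcases Int.emod_two_eq_zero_or_one m with h | h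
    · obtain ⟨p, rfl⟩ : ∃ p : ℕ, m = 2*p+2 := ⟨((m-2)/2).toNat, by omega⟩
      exact main_even A p q (by omega) s _ hx hS
    · by_cases hm : m = 1
      · subst hm; exact main_one A q s _ hx hS
      · obtain ⟨p, rfl⟩ : ∃ p : ℕ, m = 2*p+3 := ⟨((m-3)/2).toNat, by omega⟩
        exact main_odd A p q (by omega) hq s _ hx hS
  have : ∑ m ∈ Finset.Icc (1:ℤ) (2*q+2), (-1 : ℝ) ^ ((m+1).toNat) * xMon A (2*q+2) m *
      SMon A (2*q+2) m = ∑ i : Fin (2*q+1+1), CC A R⁻¹ q *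
        ((-1:ℝ)^(i:ℕ) * Vp s (bI ((i:ℤ)+1)) (2*q+1)) := by
    symm
    refine Finset.sum_bij (fun i _ => ((i:ℕ):ℤ)+1) ?_ ?_ ?_ ?_
    · intro i _
      have := i.2
      simp only [Finset.mem_Icc]; omega
    · intro i _ j _ h
      apply Fin.ext; omega
    · intro m hm
      simp only [Finset.mem_Icc] at hm
      exact ⟨⟨(m-1).toNat, by omega⟩, by simp, by simp; omega⟩
    · intro i _
      have := i.2
      rw [mul_assoc, hterm _ (by omega) (by omega)]
      have : (((i:ℕ):ℤ)+1+1).toNat = (i:ℕ)+2 := by omega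
      rw [this, pow_add]
      ring
  rw [this, ← Finset.mul_sum, hv, mul_zero]
end

section
/- Let n > 4 be an even integer, let A_1, …, A_n be points in ℝ² lying on a circle in anticlockwise order with circumradius R, and for 1 ≤ m ≤ n set δ(m) := ∏_{i=1, i≠m}^{n−1} ∏_{j=i+1, j≠m}^{n} δ_{ij} (the product of all pairwise distances among the vertices other than A_m). Then for every even m with 2 ≤ m ≤ n: δ(m) = R^{(n−2)/2} · (∏_{k=1}^{m−1} (∏_{l even, k+1 ≤ l ≤ m−1} S_{k,l,l+1} · ∏_{l odd, m+1 ≤ l ≤ n−1} S_{k,l,l+1})) · (∏_{k=m}^{n−3} ∏_{l odd, k+2 ≤ l ≤ n−1} S_{k+1,l,l+1}) · (∏_{k even, 2 ≤ k ≤ m−1} ∏_{l even, k+1 ≤ l ≤ m−1} (R² / x_{l,l+1})) · (∏_{k even, m ≤ k ≤ n−3} ∏_{l odd, k+2 ≤ l ≤ n−1} (R² / x_{l,l+1})) · (∏_{l odd, m+1 ≤ l ≤ n−1} (R^{m−2} / x_{l,l+1}^{(m−2)/2})). -/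
open Finset

/-- Distance between two points of `ℝ × ℝ`. -/
noncomputable def pdist (P Q : ℝ × ℝ) : ℝ := Real.sqrt (sqDist P Q)

/-- The product of all pairwise distances among the vertices `A_1,…,A_n` other than `A_m`. -/
noncomputable def deltaProd (A : ℤ → ℝ × ℝ) (n m : ℤ) : ℝ :=
  ∏ i ∈ (Finset.Icc 1 (n-1)).filter (fun i => i ≠ m),
    ∏ j ∈ (Finset.Icc (i+1) n).filter (fun j => j ≠ m), pdist (A i) (A j)

lemma aux_strict (n : ℤ) (θ : ℤ → ℝ) (hmono : ∀ i, 1 ≤ i → i < n → θ i < θ (i + 1))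
    (i : ℤ) (hi : 1 ≤ i) (t : ℕ) (h : i + t + 1 ≤ n) : θ i < θ (i + t + 1) := by
  induction t with
  | zero => simpa using hmono i hi (by push_cast at h; omega)
  | succ t ih =>
    have h1 := ih (by push_cast at h; omega)
    have h2 := hmono (i + t + 1) (by omega) (by push_cast at h; omega)
    have e : i + ((t + 1 : ℕ) : ℤ) + 1 = i + t + 1 + 1 := by push_cast; ring
    rw [e]; linarith

lemma aux_lt (n : ℤ) (θ : ℤ → ℝ) (hmono : ∀ i, 1 ≤ i → i < n → θ i < θ (i + 1))
    (i j : ℤ) (hi : 1 ≤ i) (hij : i < j) (hj : j ≤ n) : θ i < θ j := by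
  have := aux_strict n θ hmono i hi (j - i - 1).toNat (by omega)
  have e : i + ((j - i - 1).toNat : ℤ) + 1 = j := by omega
  rwa [e] at this

lemma aux_pdist (o1 o2 R a b : ℝ) (hR : 0 < R) (hab : a < b) (h2 : b < a + 2 * Real.pi) :
    pdist (o1 + R * Real.cos a, o2 + R * Real.sin a) (o1 + R * Real.cos b, o2 + R * Real.sin b)
      = 2 * R * Real.sin (b / 2 - a / 2) := by
  have hs : 0 < Real.sin (b / 2 - a / 2) :=
    Real.sin_pos_of_pos_of_lt_pi (by linarith) (by linarith)
  unfold pdist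
  rw [Real.sqrt_eq_iff_mul_self_eq_of_pos (by positivity)]
  unfold sqDist
  have ea : a = 2 * (a / 2) := by ring
  have eb : b = 2 * (b / 2) := by ring
  generalize a / 2 = u at *
  generalize b / 2 = v at *
  subst ea eb
  simp only [Real.sin_sub, Real.cos_two_mul, Real.sin_two_mul]
  have h1 := Real.sin_sq_add_cos_sq u
  have h2 := Real.sin_sq_add_cos_sq v
  have h1' : Real.sin u ^ 2 = 1 - Real.cos u ^ 2 := by linarith
  have h2' : Real.sin v ^ 2 = 1 - Real.cos v ^ 2 := by linarith
  ring_nf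
  rw [h1', h2']
  ring

lemma aux_S4 (o1 o2 R a b c : ℝ) :
    S4 (o1 + R * Real.cos a, o2 + R * Real.sin a) (o1 + R * Real.cos b, o2 + R * Real.sin b)
      (o1 + R * Real.cos c, o2 + R * Real.sin c)
      = 8 * R ^ 2 * Real.sin (b / 2 - a / 2) * Real.sin (c / 2 - a / 2)
        * Real.sin (c / 2 - b / 2) := by
  unfold S4
  have e : ∀ x y : ℝ, 2 * Real.sin (x / 2 - y / 2) * Real.cos (x / 2 - y / 2)
      = Real.sin x * Real.cos y - Real.cos x * Real.sin y := by
    intro x y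
    rw [← Real.sin_two_mul, ← Real.sin_sub]; congr 1; ring
  have hac : c / 2 - a / 2 = (c / 2 - b / 2) + (b / 2 - a / 2) := by ring
  have e1 := e b a
  have e2 := e c b
  have e3 := e c a
  rw [hac] at e3 ⊢
  generalize b / 2 - a / 2 = u at *
  generalize c / 2 - b / 2 = v at *
  rw [Real.sin_add, Real.cos_add] at e3
  rw [Real.sin_add]
  have h1 := Real.sin_sq_add_cos_sq u
  have h2 := Real.sin_sq_add_cos_sq v
  linear_combination (-2 * R ^ 2) * e1 + (-2 * R ^ 2) * e2 + (2 * R ^ 2) * e3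
    - 4 * R ^ 2 * Real.sin u * Real.cos u * h2 - 4 * R ^ 2 * Real.sin v * Real.cos v * h1

lemma aux_pair (a : ℤ) (t : ℕ) (f : ℤ → ℝ) (p : ℤ → Prop) [DecidablePred p]
    (hp : ∀ x, p x ↔ x % 2 = a % 2) :
    ∏ j ∈ Icc a (a + 2 * t - 1), f j
      = ∏ l ∈ (Icc a (a + 2 * t - 1)).filter p, (f l * f (l + 1)) := by
  induction t with
  | zero => simp
  | succ t ih =>
    have e1 : Icc a (a + 2 * ((t + 1 : ℕ) : ℤ) - 1)
        = insert (a + 2 * t) (insert (a + 2 * t + 1) (Icc a (a + 2 * t - 1))) := by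
      ext x; simp only [mem_insert, mem_Icc]; push_cast; omega
    have e2 : (Icc a (a + 2 * ((t + 1 : ℕ) : ℤ) - 1)).filter p
        = insert (a + 2 * t) ((Icc a (a + 2 * t - 1)).filter p) := by
      ext x; simp only [mem_insert, mem_Icc, mem_filter, hp]; push_cast; omega
    rw [e2, e1, prod_insert (by simp only [mem_insert, mem_Icc]; omega),
      prod_insert (by simp only [mem_Icc]; omega),
      prod_insert (by simp only [mem_filter, mem_Icc]; omega), ih]
    ring

lemma aux_card (a : ℤ) (t : ℕ) (p : ℤ → Prop) [DecidablePred p]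
    (hp : ∀ x, p x ↔ x % 2 = a % 2) : ((Icc a (a + 2 * t - 1)).filter p).card = t := by
  induction t with
  | zero => simp
  | succ t ih =>
    have e2 : (Icc a (a + 2 * ((t + 1 : ℕ) : ℤ) - 1)).filter p
        = insert (a + 2 * t) ((Icc a (a + 2 * t - 1)).filter p) := by
      ext x; simp only [mem_insert, mem_Icc, mem_filter, hp]; push_cast; omega
    rw [e2, card_insert_of_notMem (by simp only [mem_filter, mem_Icc]; omega), ih]

lemma aux_local (K : Finset ℤ) (e : ℕ) (hK : K.card = 2 * e + 1) (f g s : ℤ → ℝ) (D R : ℝ)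
    (hD : 0 < D) (hR : 0 < R) (hs : ∀ k ∈ K, s k = f k * g k * D / R) :
    (∏ k ∈ K, f k) * ((∏ k ∈ K, g k) * D) = R * (∏ k ∈ K, s k) * (R ^ 2 / D ^ 2) ^ e := by
  have : ∏ k ∈ K, s k = (∏ k ∈ K, f k) * (∏ k ∈ K, g k) * (D / R) ^ (2 * e + 1) := by
    rw [prod_congr rfl hs, ← hK, ← prod_const, ← prod_mul_distrib, ← prod_mul_distrib]
    exact prod_congr rfl fun k _ => by ring
  rw [this, pow_succ, pow_mul, div_pow D R 2]
  have h : (D ^ 2 / R ^ 2) ^ e * (R ^ 2 / D ^ 2) ^ e = 1 := by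
    rw [← mul_pow]
    have : D ^ 2 / R ^ 2 * (R ^ 2 / D ^ 2) = 1 := by field_simp
    rw [this, one_pow]
  have h' : R * (D / R) = D := by field_simp
  linear_combination (-(∏ k ∈ K, f k) * (∏ k ∈ K, g k) * R * (D / R)) * h
    - (∏ k ∈ K, f k) * (∏ k ∈ K, g k) * h'

theorem stmt12 (n : ℤ) (hn : 4 < n) (hne : Even n) (A : ℤ → ℝ × ℝ)
    (O : ℝ × ℝ) (R : ℝ) (θ : ℤ → ℝ) (hR : 0 < R)
    (hmono : ∀ i, 1 ≤ i → i < n → θ i < θ (i + 1))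
    (hwrap : θ n < θ 1 + 2 * Real.pi)
    (hA : ∀ i, 1 ≤ i → i ≤ n → A i = (O.1 + R * Real.cos (θ i), O.2 + R * Real.sin (θ i)))
    (m : ℤ) (hm1 : 2 ≤ m) (hm2 : m ≤ n) (hme : Even m) :
    deltaProd A n m =
      R ^ (((n-2)/2).toNat) *
      (∏ k ∈ Finset.Icc 1 (m-1),
        ((∏ l ∈ (Finset.Icc (k+1) (m-1)).filter (fun l => Even l),
            S4 (A k) (A l) (A (l+1))) *
         (∏ l ∈ (Finset.Icc (m+1) (n-1)).filter (fun l => Odd l),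
            S4 (A k) (A l) (A (l+1))))) *
      (∏ k ∈ Finset.Icc m (n-3),
        ∏ l ∈ (Finset.Icc (k+2) (n-1)).filter (fun l => Odd l),
          S4 (A (k+1)) (A l) (A (l+1))) *
      (∏ k ∈ (Finset.Icc 2 (m-1)).filter (fun k => Even k),
        ∏ l ∈ (Finset.Icc (k+1) (m-1)).filter (fun l => Even l),
          (R^2 / sqDist (A l) (A (l+1)))) *
      (∏ k ∈ (Finset.Icc m (n-3)).filter (fun k => Even k),
        ∏ l ∈ (Finset.Icc (k+2) (n-1)).filter (fun l => Odd l),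
          (R^2 / sqDist (A l) (A (l+1)))) *
      (∏ l ∈ (Finset.Icc (m+1) (n-1)).filter (fun l => Odd l),
        (R ^ ((m-2).toNat) / (sqDist (A l) (A (l+1))) ^ (((m-2)/2).toNat))) := by
  obtain ⟨a, rfl⟩ := hme
  obtain ⟨b, rfl⟩ := hne
  set m := a + a with hm
  set n := b + b with hnn
  have hlt : ∀ i j, 1 ≤ i → i < j → j ≤ n → θ i < θ j := aux_lt n θ hmono
  have hle1 : ∀ i, 1 ≤ i → i ≤ n → θ 1 ≤ θ i := by
    intro i h1 h2
    rcases eq_or_lt_of_le h1 with h | h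
    · rw [← h]
    · exact (hlt 1 i le_rfl h h2).le
  have hlen : ∀ i, 1 ≤ i → i ≤ n → θ i ≤ θ n := by
    intro i h1 h2
    rcases eq_or_lt_of_le h2 with h | h
    · rw [← h]
    · exact (hlt i n h1 h le_rfl).le
  have hd : ∀ i j, 1 ≤ i → i < j → j ≤ n →
      pdist (A i) (A j) = 2 * R * Real.sin (θ j / 2 - θ i / 2) := by
    intro i j h1 h2 h3
    rw [hA i h1 (by omega), hA j (by omega) h3]
    refine aux_pdist _ _ _ _ _ hR (hlt i j h1 h2 h3) ?_
    have := hle1 i h1 (by omega)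
    have := hlen j (by omega) h3
    linarith
  have hpos : ∀ i j, 1 ≤ i → i < j → j ≤ n → 0 < pdist (A i) (A j) := by
    intro i j h1 h2 h3
    rw [hd i j h1 h2 h3]
    have := hle1 i h1 (by omega)
    have := hlen j (by omega) h3
    have := hlt i j h1 h2 h3
    have : 0 < Real.sin (θ j / 2 - θ i / 2) :=
      Real.sin_pos_of_pos_of_lt_pi (by linarith) (by linarith)
    positivity
  have hS : ∀ k l, 1 ≤ k → k < l → l + 1 ≤ n → S4 (A k) (A l) (A (l+1)) =
      pdist (A k) (A l) * pdist (A k) (A (l+1)) * pdist (A l) (A (l+1)) / R := by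
    intro k l h1 h2 h3
    rw [hd k l h1 h2 (by omega), hd k (l+1) h1 (by omega) h3, hd l (l+1) (by omega) (by omega) h3,
      hA k h1 (by omega), hA l (by omega) (by omega), hA (l+1) (by omega) h3, aux_S4]
    field_simp
    ring
  have hsq : ∀ P Q, sqDist P Q = pdist P Q ^ 2 := by
    intro P Q
    unfold pdist
    rw [Real.sq_sqrt]
    unfold sqDist; positivity
  have hEv : ∀ x : ℤ, Even x ↔ x % 2 = 0 := fun x => Int.even_iff
  have hOd : ∀ x : ℤ, Odd x ↔ x % 2 = 1 := fun x => Int.odd_iff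
  set E := (Icc 2 (m-1)).filter (fun l : ℤ => Even l) with hE
  set F := (Icc (m+1) (n-1)).filter (fun l : ℤ => Odd l) with hF
  have hE' : E = (Icc 2 (2 + 2 * ((a - 1).toNat : ℤ) - 1)).filter (fun l : ℤ => Even l) := by
    rw [hE]; congr 2; omega
  have hF' : F = (Icc (m+1) (m + 1 + 2 * ((b - a).toNat : ℤ) - 1)).filter
      (fun l : ℤ => Odd l) := by
    ext x; simp only [hF, mem_filter, mem_Icc, hOd]; omega
  have hEc : E.card = (a - 1).toNat := by
    rw [hE']; exact aux_card 2 _ _ (fun x => by rw [hEv]; omega)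
  have hFc : F.card = (b - a).toNat := by
    rw [hF']; exact aux_card (m+1) _ _ (fun x => by rw [hOd]; omega)
  set C : ℤ → ℝ := fun j => ∏ i ∈ (Icc 1 (j-1)).filter (fun i => i ≠ m), pdist (A i) (A j)
    with hC
  -- left side
  have hL : deltaProd A n m = (∏ l ∈ E, (C l * C (l+1))) * ∏ l ∈ F, (C l * C (l+1)) := by
    have h1 : deltaProd A n m = ∏ j ∈ (Icc 1 n).filter (fun j => j ≠ m), C j := by
      unfold deltaProd
      rw [hC]
      apply prod_comm'
      intro x y
      simp only [mem_filter, mem_Icc]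
      omega
    have h2 : (Icc 1 n).filter (fun j => j ≠ m)
        = insert 1 (Icc 2 (2 + 2 * ((a - 1).toNat : ℤ) - 1) ∪
            Icc (m+1) (m + 1 + 2 * ((b - a).toNat : ℤ) - 1)) := by
      ext x; simp only [mem_filter, mem_Icc, mem_insert, mem_union]; omega
    have h3 : C 1 = 1 := by simp [hC]
    rw [h1, h2, prod_insert (by simp only [mem_union, mem_Icc]; omega), h3, one_mul,
      prod_union, aux_pair 2 _ C (fun l => Even l) (fun x => by rw [hEv]; omega),
      aux_pair (m+1) _ C (fun l => Odd l) (fun x => by rw [hOd]; omega), hE', hF']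
    rw [disjoint_left]
    intro x
    simp only [mem_Icc]
    omega
  -- right side
  have hRp : R ^ (((n-2)/2).toNat) = (∏ l ∈ E, R) * ∏ l ∈ F, R := by
    rw [prod_const, prod_const, hEc, hFc, ← pow_add]
    congr 1; omega
  have hP1 : (∏ k ∈ Finset.Icc 1 (m-1),
        ((∏ l ∈ (Finset.Icc (k+1) (m-1)).filter (fun l => Even l),
            S4 (A k) (A l) (A (l+1))) *
         (∏ l ∈ F, S4 (A k) (A l) (A (l+1)))))
      = (∏ l ∈ E, ∏ k ∈ Icc 1 (l-1), S4 (A k) (A l) (A (l+1))) *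
        ∏ l ∈ F, ∏ k ∈ Icc 1 (m-1), S4 (A k) (A l) (A (l+1)) := by
    rw [prod_mul_distrib]
    congr 1
    · apply prod_comm'
      intro x y
      simp only [hE, mem_filter, mem_Icc, hEv]
      omega
    · exact prod_comm
  have hP2 : (∏ k ∈ Finset.Icc m (n-3),
        ∏ l ∈ (Finset.Icc (k+2) (n-1)).filter (fun l => Odd l),
          S4 (A (k+1)) (A l) (A (l+1)))
      = ∏ l ∈ F, ∏ k ∈ Icc (m+1) (l-1), S4 (A k) (A l) (A (l+1)) := by
    have h1 : (∏ k ∈ Finset.Icc m (n-3),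
        ∏ l ∈ (Finset.Icc (k+2) (n-1)).filter (fun l => Odd l),
          S4 (A (k+1)) (A l) (A (l+1)))
      = ∏ l ∈ F, ∏ k ∈ Icc m (l-2), S4 (A (k+1)) (A l) (A (l+1)) := by
      apply prod_comm'
      intro x y
      simp only [hF, mem_filter, mem_Icc, hOd]
      omega
    rw [h1]
    refine prod_congr rfl fun l _ => ?_
    refine prod_bij (fun k _ => k + 1) ?_ ?_ ?_ ?_
    · intro k; simp only [mem_Icc]; omega
    · intro x _ y _ h; simpa using h
    · intro y hy; simp only [mem_Icc] at hy
      exact ⟨y - 1, by simp only [mem_Icc]; omega, by ring⟩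
    · intros; rfl
  have hP3 : (∏ k ∈ E,
        ∏ l ∈ (Finset.Icc (k+1) (m-1)).filter (fun l => Even l),
          (R^2 / sqDist (A l) (A (l+1))))
      = ∏ l ∈ E, (R^2 / pdist (A l) (A (l+1)) ^ 2) ^ ((l-2)/2).toNat := by
    have h1 : (∏ k ∈ E,
        ∏ l ∈ (Finset.Icc (k+1) (m-1)).filter (fun l => Even l),
          (R^2 / sqDist (A l) (A (l+1))))
      = ∏ l ∈ E, ∏ k ∈ (Icc 2 (l-1)).filter (fun l => Even l),
          (R^2 / sqDist (A l) (A (l+1))) := by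
      apply prod_comm'
      intro x y
      simp only [hE, mem_filter, mem_Icc, hEv]
      omega
    rw [h1]
    refine prod_congr rfl fun l hl => ?_
    simp only [hE, mem_filter, mem_Icc, hEv] at hl
    rw [prod_const, hsq]
    congr 1
    have : l - 1 = 2 + 2 * (((l-2)/2).toNat : ℤ) - 1 := by omega
    rw [this]
    exact aux_card 2 _ _ (fun x => by rw [hEv]; omega)
  have hP4 : (∏ k ∈ (Finset.Icc m (n-3)).filter (fun k => Even k),
        ∏ l ∈ (Finset.Icc (k+2) (n-1)).filter (fun l => Odd l),
          (R^2 / sqDist (A l) (A (l+1))))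
      = ∏ l ∈ F, (R^2 / pdist (A l) (A (l+1)) ^ 2) ^ ((l-1-m)/2).toNat := by
    have h1 : (∏ k ∈ (Finset.Icc m (n-3)).filter (fun k => Even k),
        ∏ l ∈ (Finset.Icc (k+2) (n-1)).filter (fun l => Odd l),
          (R^2 / sqDist (A l) (A (l+1))))
      = ∏ l ∈ F, ∏ k ∈ (Icc m (l-2)).filter (fun l => Even l),
          (R^2 / sqDist (A l) (A (l+1))) := by
      apply prod_comm'
      intro x y
      simp only [hF, mem_filter, mem_Icc, hOd, hEv]
      omega
    rw [h1]
    refine prod_congr rfl fun l hl => ?_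
    simp only [hF, mem_filter, mem_Icc, hOd] at hl
    rw [prod_const, hsq]
    congr 1
    have : l - 2 = m + 2 * (((l-1-m)/2).toNat : ℤ) - 1 := by omega
    rw [this]
    exact aux_card m _ _ (fun x => by rw [hEv]; omega)
  have hP5 : (∏ l ∈ F,
        (R ^ ((m-2).toNat) / (sqDist (A l) (A (l+1))) ^ (((m-2)/2).toNat)))
      = ∏ l ∈ F, (R^2 / pdist (A l) (A (l+1)) ^ 2) ^ ((m-2)/2).toNat := by
    refine prod_congr rfl fun l hl => ?_
    rw [hsq, div_pow, ← pow_mul R]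
    congr 2
    omega
  have hEl : ∀ l ∈ E, C l * C (l+1) = R * (∏ k ∈ Icc 1 (l-1), S4 (A k) (A l) (A (l+1))) *
      (R^2 / pdist (A l) (A (l+1)) ^ 2) ^ ((l-2)/2).toNat := by
    intro l hl
    simp only [hE, mem_filter, mem_Icc, hEv] at hl
    have e1 : (Icc 1 (l-1)).filter (fun i => i ≠ m) = Icc 1 (l-1) := by
      ext x; simp only [mem_filter, mem_Icc]; omega
    have e2 : (Icc 1 (l+1-1)).filter (fun i => i ≠ m) = insert l (Icc 1 (l-1)) := by
      ext x; simp only [mem_filter, mem_Icc, mem_insert]; omega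
    simp only [hC]
    rw [e1, e2, prod_insert (by simp only [mem_Icc]; omega), mul_comm (pdist (A l) (A (l+1)))]
    refine aux_local _ _ ?_ _ _ _ _ _ (hpos l (l+1) (by omega) (by omega) (by omega)) hR ?_
    · rw [Int.card_Icc]; omega
    · intro k hk
      simp only [mem_Icc] at hk
      exact hS k l (by omega) (by omega) (by omega)
  have hFl : ∀ l ∈ F, C l * C (l+1) = R * ((∏ k ∈ Icc 1 (m-1), S4 (A k) (A l) (A (l+1))) *
      (∏ k ∈ Icc (m+1) (l-1), S4 (A k) (A l) (A (l+1)))) *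
      (R^2 / pdist (A l) (A (l+1)) ^ 2) ^ (((l-1-m)/2).toNat + ((m-2)/2).toNat) := by
    intro l hl
    simp only [hF, mem_filter, mem_Icc, hOd] at hl
    have hdj : Disjoint (Icc 1 (m-1)) (Icc (m+1) (l-1)) := by
      rw [disjoint_left]; intro x; simp only [mem_Icc]; omega
    have e1 : (Icc 1 (l-1)).filter (fun i => i ≠ m) = Icc 1 (m-1) ∪ Icc (m+1) (l-1) := by
      ext x; simp only [mem_filter, mem_Icc, mem_union]; omega
    have e2 : (Icc 1 (l+1-1)).filter (fun i => i ≠ m)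
        = insert l (Icc 1 (m-1) ∪ Icc (m+1) (l-1)) := by
      ext x; simp only [mem_filter, mem_Icc, mem_insert, mem_union]; omega
    simp only [hC]
    rw [e1, e2, prod_insert (by simp only [mem_Icc, mem_union]; omega),
      mul_comm (pdist (A l) (A (l+1))), ← prod_union hdj]
    refine aux_local _ _ ?_ _ _ _ _ _ (hpos l (l+1) (by omega) (by omega) (by omega)) hR ?_
    · rw [card_union_of_disjoint hdj, Int.card_Icc, Int.card_Icc]; omega
    · intro k hk
      simp only [mem_Icc, mem_union] at hk
      exact hS k l (by omega) (by omega) (by omega)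
  rw [hL, hRp, hP1, hP2, hP3, hP4, hP5, prod_congr rfl hEl, prod_congr rfl hFl]
  simp only [prod_mul_distrib, pow_add]
  ring
end

section
/- Let n > 4 be an even integer, let A_1, …, A_n be points in ℝ² lying on a circle in anticlockwise order with circumradius R, and set δ(3) := ∏_{i=1, i≠3}^{n−1} ∏_{j=i+1, j≠3}^{n} δ_{ij} (the product of all pairwise distances among the vertices other than A_3). Then δ(3) = S_{124}·R · (∏_{l odd, 5 ≤ l ≤ n−1} S_{1,l,l+1}·S_{2,l,l+1}·R²) · (∏_{k=3}^{n−3} ∏_{l odd, k+2 ≤ l ≤ n−1} S_{k+1,l,l+1}·R) · (∏_{k odd, 3 ≤ k ≤ n−3} ∏_{l odd, k+2 ≤ l ≤ n−1} (1 / x_{l,l+1})). -/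
open Finset

lemma aux_top (f : ℤ → ℝ) (a b : ℤ) (h : a ≤ b + 1) :
    ∏ i ∈ Finset.Icc a (b+1), f i = (∏ i ∈ Finset.Icc a b, f i) * f (b+1) := by
  have : Finset.Icc a (b+1) = insert (b+1) (Finset.Icc a b) := by
    ext x; simp only [Finset.mem_insert, Finset.mem_Icc]; omega
  rw [this, Finset.prod_insert (by simp), mul_comm]

lemma aux_c (c : ℝ) (hc : c ≠ 0) (m : ℕ) :
    ∏ k ∈ Finset.Icc (3:ℤ) (2 * (m:ℤ) + 3), (c * if Odd k then 1 / c^2 else 1) = 1 / c := by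
  induction m with
  | zero => simp [show Odd (3:ℤ) by decide]; field_simp
  | succ m ih =>
    rw [show 2 * ((m+1:ℕ):ℤ) + 3 = (2 * (m:ℤ) + 3 + 1) + 1 by push_cast; ring,
      aux_top _ _ _ (by omega), aux_top _ _ _ (by omega), ih]
    have h1 : ¬ Odd (2 * (m:ℤ) + 3 + 1) := by
      rw [Int.not_odd_iff_even]; exact ⟨m+2, by ring⟩
    have h2 : Odd (2 * (m:ℤ) + 3 + 1 + 1) := ⟨m+2, by ring⟩
    rw [if_neg h1, if_pos h2]
    field_simp

/-- product of the distances to lower vertices -/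
noncomputable def auxG (d : ℤ → ℤ → ℝ) (j : ℤ) : ℝ :=
  ∏ i ∈ Finset.Icc 1 (j-1), if i ≠ 3 then d i j else 1

/-- the factor of an odd index -/
noncomputable def auxF (d : ℤ → ℤ → ℝ) (l : ℤ) : ℝ :=
  (d 1 l * d 1 (l+1) * d l (l+1)) * (d 2 l * d 2 (l+1) * d l (l+1)) *
  (∏ k ∈ Finset.Icc 3 (l-2), (d (k+1) l * d (k+1) (l+1) * d l (l+1))) *
  ∏ k ∈ Finset.Icc 3 (l-2), if Odd k then 1 / (d l (l+1))^2 else 1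

lemma aux_shift (f : ℤ → ℝ) (b : ℕ) :
    ∏ i ∈ Finset.Icc (1:ℤ) (b+4), (if i ≠ 3 then f i else 1) =
      f 1 * f 2 * ∏ k ∈ Finset.Icc (3:ℤ) (b+3), f (k+1) := by
  induction b with
  | zero =>
    have : Finset.Icc (1:ℤ) 4 = {1,2,3,4} := by decide
    simp [this, mul_assoc]
  | succ b ih =>
    rw [show (((b+1:ℕ):ℤ)+4) = (b + 4 : ℤ) + 1 by push_cast; ring,
      show (((b+1:ℕ):ℤ)+3) = (b + 3 : ℤ) + 1 by push_cast; ring,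
      aux_top _ _ _ (by omega), aux_top _ _ _ (by omega), ih, if_pos (by omega),
      show (b:ℤ)+3+1+1 = b+4+1 by ring]
    ring

lemma aux_step (d : ℤ → ℤ → ℝ) (m : ℕ) (hc : d (2*m+5) (2*m+6) ≠ 0) :
    auxF d (2*m+5) = auxG d (2*m+5) * auxG d (2*m+6) := by
  have e : (2*(m:ℤ)+5)+1 = 2*m+6 := by ring
  have s1 := aux_shift (fun i => d i (2*m+5)) (2*m)
  have s2 := aux_shift (fun i => d i (2*m+6)) (2*m)
  have c1 := aux_c _ hc m
  push_cast at s1 s2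
  have g1 : auxG d (2*m+5) = d 1 (2*m+5) * d 2 (2*m+5) *
      ∏ k ∈ Finset.Icc (3:ℤ) (2*m+3), d (k+1) (2*m+5) := by
    rw [← s1, auxG, show 2*(m:ℤ)+5-1 = 2*m+4 by ring]
  have g2 : auxG d (2*m+6) = (d 1 (2*m+6) * d 2 (2*m+6) *
      ∏ k ∈ Finset.Icc (3:ℤ) (2*m+3), d (k+1) (2*m+6)) * d (2*m+5) (2*m+6) := by
    rw [← s2, auxG, show 2*(m:ℤ)+6-1 = (2*m+4)+1 by ring, aux_top _ _ _ (by omega),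
      if_pos (by omega), show 2*(m:ℤ)+4+1 = 2*m+5 by ring]
  rw [g1, g2, auxF, e, show 2*(m:ℤ)+5-2 = 2*m+3 by ring]
  rw [Finset.prod_mul_distrib] at c1
  rw [Finset.prod_mul_distrib, Finset.prod_mul_distrib]
  generalize (∏ k ∈ Finset.Icc (3:ℤ) (2*m+3), d (k+1) (2*m+5)) = P1 at *
  generalize (∏ k ∈ Finset.Icc (3:ℤ) (2*m+3), d (k+1) (2*m+6)) = P2 at *
  generalize (∏ k ∈ Finset.Icc (3:ℤ) (2*m+3), d (2*m+5) (2*m+6)) = C1 at *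
  generalize (∏ k ∈ Finset.Icc (3:ℤ) (2*m+3),
    if Odd k then 1 / d (2*m+5) (2*m+6) ^ 2 else 1) = C2 at *
  generalize d (2*m+5) (2*m+6) = c at *
  have c2 : c * c * (C1 * C2) = c := by rw [c1]; field_simp
  linear_combination (d 1 (2*m+5) * d 2 (2*m+5) * P1 * d 1 (2*m+6) * d 2 (2*m+6) * P2) * c2

lemma aux_main (d : ℤ → ℤ → ℝ) (m : ℕ)
    (hc : ∀ k : ℕ, k < m → d (2*k+5) (2*k+6) ≠ 0) :
    (∏ j ∈ Finset.Icc (2:ℤ) (2*m+4), if j ≠ 3 then auxG d j else 1) =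
      d 1 2 * d 1 4 * d 2 4 *
      ∏ l ∈ Finset.Icc (5:ℤ) (2*m+3), if Odd l then auxF d l else 1 := by
  induction m with
  | zero =>
    have h : Finset.Icc (2:ℤ) 4 = {2,3,4} := by decide
    have h3 : Finset.Icc (1:ℤ) 3 = {1,2,3} := by decide
    simp only [Nat.cast_zero, mul_zero, zero_add, h]
    simp [auxG]
    rw [h3]
    simp [mul_assoc]
  | succ m ih =>
    have h1 : ¬ Odd (2 * (m:ℤ) + 3 + 1) := by
      rw [Int.not_odd_iff_even]; exact ⟨m+2, by ring⟩
    have hE : (∏ l ∈ Finset.Icc (5:ℤ) (2*m+3+1), if Odd l then auxF d l else 1) =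
        ∏ l ∈ Finset.Icc (5:ℤ) (2*m+3), if Odd l then auxF d l else 1 := by
      rcases Nat.eq_zero_or_pos m with h | h
      · subst h; simp
      · rw [aux_top _ 5 (2 * (m:ℤ) + 3) (by omega), if_neg h1, mul_one]
    rw [show 2 * ((m+1:ℕ):ℤ) + 4 = (2 * (m:ℤ) + 4 + 1) + 1 by push_cast; ring,
      show 2 * ((m+1:ℕ):ℤ) + 3 = (2 * (m:ℤ) + 3 + 1) + 1 by push_cast; ring,
      aux_top _ 2 (2 * (m:ℤ) + 4 + 1) (by omega), aux_top _ 2 (2 * (m:ℤ) + 4) (by omega),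
      aux_top _ 5 (2 * (m:ℤ) + 3 + 1) (by omega), hE,
      ih (fun k hk => hc k (by omega))]
    have h2 : Odd (2 * (m:ℤ) + 3 + 1 + 1) := ⟨m+2, by ring⟩
    rw [if_pos h2, if_pos (show 2 * (m:ℤ) + 4 + 1 ≠ 3 by omega),
      if_pos (show 2 * (m:ℤ) + 4 + 1 + 1 ≠ 3 by omega)]
    rw [show 2 * (m:ℤ) + 3 + 1 + 1 = 2*m+5 by ring, show 2 * (m:ℤ) + 4 + 1 = 2*m+5 by ring,
      show 2 * (m:ℤ) + 5 + 1 = 2*m+6 by ring, aux_step d m (hc m (by omega))]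
    ring

lemma aux_sq (O : ℝ × ℝ) (R p q : ℝ) :
    sqDist (O.1 + R * Real.cos p, O.2 + R * Real.sin p)
      (O.1 + R * Real.cos q, O.2 + R * Real.sin q) = (2 * R * Real.sin ((q-p)/2))^2 := by
  have h1 := Real.cos_sub_cos q p
  have h2 := Real.sin_sub_sin q p
  have h3 := Real.sin_sq_add_cos_sq ((q+p)/2)
  have e1 : (O.1 + R * Real.cos q) - (O.1 + R * Real.cos p) = R * (Real.cos q - Real.cos p) := by
    ring
  have e2 : (O.2 + R * Real.sin q) - (O.2 + R * Real.sin p) = R * (Real.sin q - Real.sin p) := by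
    ring
  simp only [sqDist]
  rw [e1, e2, h1, h2]
  linear_combination (4 * R^2 * Real.sin ((q-p)/2)^2) * h3

lemma aux_S (O : ℝ × ℝ) (R p q t : ℝ) :
    S4 (O.1 + R * Real.cos p, O.2 + R * Real.sin p)
      (O.1 + R * Real.cos q, O.2 + R * Real.sin q)
      (O.1 + R * Real.cos t, O.2 + R * Real.sin t) * R =
      (2 * R * Real.sin ((q-p)/2)) * (2 * R * Real.sin ((t-p)/2)) *
        (2 * R * Real.sin ((t-q)/2)) := by
  have e1 : ∀ q p, (O.1 + R * Real.cos q) - (O.1 + R * Real.cos p) =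
      R * (Real.cos q - Real.cos p) := by intros; ring
  have e2 : ∀ q p, (O.2 + R * Real.sin q) - (O.2 + R * Real.sin p) =
      R * (Real.sin q - Real.sin p) := by intros; ring
  have h3 := Real.sin_sub ((t+p)/2) ((q+p)/2)
  rw [show (t+p)/2 - (q+p)/2 = (t-q)/2 by ring] at h3
  simp only [S4]
  rw [e1, e1, e2, e2, Real.cos_sub_cos, Real.cos_sub_cos, Real.sin_sub_sin, Real.sin_sub_sin, h3]
  ring

theorem stmt14 (n : ℤ) (hn : 4 < n) (hne : Even n) (A : ℤ → ℝ × ℝ)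
    (O : ℝ × ℝ) (R : ℝ) (θ : ℤ → ℝ) (hR : 0 < R)
    (hmono : ∀ i, 1 ≤ i → i < n → θ i < θ (i + 1))
    (hwrap : θ n < θ 1 + 2 * Real.pi)
    (hA : ∀ i, 1 ≤ i → i ≤ n → A i = (O.1 + R * Real.cos (θ i), O.2 + R * Real.sin (θ i))) :
    deltaProd A n 3 =
      S4 (A 1) (A 2) (A 4) * R *
      (∏ l ∈ (Finset.Icc 5 (n-1)).filter (fun l => Odd l),
        (S4 (A 1) (A l) (A (l+1)) * S4 (A 2) (A l) (A (l+1)) * R^2)) *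
      (∏ k ∈ Finset.Icc 3 (n-3),
        ∏ l ∈ (Finset.Icc (k+2) (n-1)).filter (fun l => Odd l),
          (S4 (A (k+1)) (A l) (A (l+1)) * R)) *
      (∏ k ∈ (Finset.Icc 3 (n-3)).filter (fun k => Odd k),
        ∏ l ∈ (Finset.Icc (k+2) (n-1)).filter (fun l => Odd l),
          (1 / sqDist (A l) (A (l+1)))) := by
  have hlt : ∀ i j, 1 ≤ i → i < j → j ≤ n → θ i < θ j := by
    intro i j hi hij
    induction j, (show i + 1 ≤ j by omega) using Int.le_induction with
    | base => intro h; exact hmono i hi (by omega)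
    | succ j hj ih =>
      intro h
      exact (ih (by omega) (by omega)).trans (hmono j (by omega) (by omega))
  have hle : ∀ i j, 1 ≤ i → i ≤ j → j ≤ n → θ i ≤ θ j := by
    intro i j hi hij hj
    rcases hij.eq_or_lt with h | h
    · rw [h]
    · exact (hlt i j hi h hj).le
  set d : ℤ → ℤ → ℝ := fun i j => 2 * R * Real.sin ((θ j - θ i)/2) with hd
  have hpos : ∀ i j, 1 ≤ i → i < j → j ≤ n → 0 < d i j := by
    intro i j hi hij hj
    have h1 := hlt i j hi hij hj
    have h2 := hle 1 i le_rfl hi (by omega)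
    have h3 := hle j n (by omega) hj le_rfl
    have := Real.sin_pos_of_pos_of_lt_pi (x := (θ j - θ i)/2) (by linarith) (by linarith)
    simp only [hd]; positivity
  have hsq : ∀ i j, 1 ≤ i → i < j → j ≤ n → sqDist (A i) (A j) = (d i j)^2 := by
    intro i j hi hij hj
    rw [hA i hi (by omega), hA j (by omega) hj, aux_sq]
  have hpd : ∀ i j, 1 ≤ i → i < j → j ≤ n → pdist (A i) (A j) = d i j := by
    intro i j hi hij hj
    rw [pdist, hsq i j hi hij hj, Real.sqrt_sq (hpos i j hi hij hj).le]
  have hS : ∀ i j k, 1 ≤ i → i < j → j < k → k ≤ n →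
      S4 (A i) (A j) (A k) * R = d i j * d i k * d j k := by
    intro i j k hi hij hjk hk
    rw [hA i hi (by omega), hA j (by omega) (by omega), hA k (by omega) hk, aux_S]
  obtain ⟨N, hN⟩ := hne
  obtain ⟨m, hm⟩ : ∃ m : ℕ, n = 2 * m + 4 := ⟨(N-2).toNat, by omega⟩
  have key := aux_main d m (fun k hk => (hpos _ _ (by omega) (by omega) (by omega)).ne')
  rw [← hm, show 2*(m:ℤ)+3 = n - 1 by omega] at key
  have L : deltaProd A n 3 = ∏ j ∈ Finset.Icc (2:ℤ) n, if j ≠ 3 then auxG d j else 1 := by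
    rw [deltaProd, ← Finset.prod_filter]
    simp only [auxG, ← Finset.prod_filter]
    rw [Finset.prod_comm' (s' := fun j => (Finset.Icc 1 (j-1)).filter (fun i => i ≠ 3))
      (t' := (Finset.Icc 2 n).filter (fun j => j ≠ 3))
      (by intro x y; simp only [Finset.mem_filter, Finset.mem_Icc]; omega)]
    refine Finset.prod_congr rfl fun j hj => Finset.prod_congr rfl fun i hi => ?_
    simp only [Finset.mem_filter, Finset.mem_Icc] at hi hj
    exact hpd i j (by omega) (by omega) (by omega)
  rw [L, key, hS 1 2 4 (by omega) (by omega) (by omega) (by omega), ← Finset.prod_filter]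
  rw [Finset.prod_comm' (s := Finset.Icc 3 (n-3)) (s' := fun l => Finset.Icc 3 (l-2))
      (t' := (Finset.Icc 5 (n-1)).filter (fun j => Odd j))
      (by intro x y; simp only [Finset.mem_filter, Finset.mem_Icc]; grind)]
  rw [Finset.prod_comm' (s := (Finset.Icc 3 (n-3)).filter (fun k => Odd k))
      (s' := fun l => (Finset.Icc 3 (l-2)).filter (fun k => Odd k))
      (t' := (Finset.Icc 5 (n-1)).filter (fun j => Odd j))
      (by intro x y; simp only [Finset.mem_filter, Finset.mem_Icc]; grind)]
  generalize d 1 2 * d 1 4 * d 2 4 = D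
  rw [mul_assoc D, mul_assoc D, ← Finset.prod_mul_distrib, ← Finset.prod_mul_distrib]
  congr 1
  refine Finset.prod_congr rfl fun l hl => ?_
  simp only [Finset.mem_filter, Finset.mem_Icc] at hl
  have r1 : S4 (A 1) (A l) (A (l+1)) * S4 (A 2) (A l) (A (l+1)) * R^2 =
      (d 1 l * d 1 (l+1) * d l (l+1)) * (d 2 l * d 2 (l+1) * d l (l+1)) := by
    rw [← hS 1 l (l+1) (by omega) (by omega) (by omega) (by omega),
      ← hS 2 l (l+1) (by omega) (by omega) (by omega) (by omega)]
    ring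
  rw [r1, auxF, ← Finset.prod_filter, hsq l (l+1) (by omega) (by omega) (by omega)]
  have r2 : ∏ k ∈ Finset.Icc 3 (l-2), (S4 (A (k+1)) (A l) (A (l+1)) * R) =
      ∏ k ∈ Finset.Icc 3 (l-2), (d (k+1) l * d (k+1) (l+1) * d l (l+1)) := by
    refine Finset.prod_congr rfl fun k hk => ?_
    simp only [Finset.mem_Icc] at hk
    rw [hS (k+1) l (l+1) (by omega) (by omega) (by omega) (by omega)]
  rw [r2]
end

section
/- Let A, B, C, D be four distinct points in ℝ² lying on a circle in anticlockwise order (in this order). Then, abbreviating x_{PQ} := x(P,Q) and S_{PQT} := S(P,Q,T), one has S_{ABC}·x_{BD}·x_{CD} − S_{ABD}·x_{AC}·x_{CD} + S_{ACD}·x_{AB}·x_{BD} − S_{BCD}·x_{AB}·x_{AC} = 0. -/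
theorem chordAux (O : ℝ × ℝ) (R a b : ℝ) :
    sqDist (O.1 + R * Real.cos (2*a), O.2 + R * Real.sin (2*a))
      (O.1 + R * Real.cos (2*b), O.2 + R * Real.sin (2*b)) = 4 * R^2 * Real.sin (b - a)^2 := by
  have h1 := Real.sin_sq_add_cos_sq a
  have h2 := Real.sin_sq_add_cos_sq b
  simp only [sqDist, Real.cos_two_mul, Real.sin_two_mul, Real.sin_sub]
  grind

theorem areaAux (O : ℝ × ℝ) (R a b c : ℝ) :
    S4 (O.1 + R * Real.cos (2*a), O.2 + R * Real.sin (2*a))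
      (O.1 + R * Real.cos (2*b), O.2 + R * Real.sin (2*b))
      (O.1 + R * Real.cos (2*c), O.2 + R * Real.sin (2*c))
      = 8 * R^2 * (Real.sin (b - a) * Real.sin (c - b) * Real.sin (c - a)) := by
  have h1 := Real.sin_sq_add_cos_sq a
  have h2 := Real.sin_sq_add_cos_sq b
  have h3 := Real.sin_sq_add_cos_sq c
  simp only [S4, Real.cos_two_mul, Real.sin_two_mul, Real.sin_sub]
  grind

theorem sinAux (u v w : ℝ) : Real.sin (v+w) * Real.sin w - Real.sin u * Real.sin (u+v)
    + Real.sin (u+v+w) * Real.sin (u-w) = 0 := by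
  have h1 := Real.sin_sq_add_cos_sq u
  have h2 := Real.sin_sq_add_cos_sq v
  have h3 := Real.sin_sq_add_cos_sq w
  simp only [Real.sin_add, Real.cos_add, Real.sin_sub]
  grind

theorem sinAux2 (u v w : ℝ) : Real.sin u * Real.sin (v+w) - Real.sin (u+v) * Real.sin w
    = Real.sin v * Real.sin (u-w) := by
  simp only [Real.sin_add, Real.sin_sub]
  ring

theorem stmt16 (A B C D : ℝ × ℝ)
    (hdist : A ≠ B ∧ A ≠ C ∧ A ≠ D ∧ B ≠ C ∧ B ≠ D ∧ C ≠ D)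
    (hcirc : ∃ (O : ℝ × ℝ) (R tA tB tC tD : ℝ), 0 < R ∧
      tA < tB ∧ tB < tC ∧ tC < tD ∧ tD < tA + 2 * Real.pi ∧
      A = (O.1 + R * Real.cos tA, O.2 + R * Real.sin tA) ∧
      B = (O.1 + R * Real.cos tB, O.2 + R * Real.sin tB) ∧
      C = (O.1 + R * Real.cos tC, O.2 + R * Real.sin tC) ∧
      D = (O.1 + R * Real.cos tD, O.2 + R * Real.sin tD)) :
    S4 A B C * sqDist B D * sqDist C D - S4 A B D * sqDist A C * sqDist C D +
      S4 A C D * sqDist A B * sqDist B D - S4 B C D * sqDist A B * sqDist A C = 0 := by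
  obtain ⟨O, R, tA, tB, tC, tD, -, -, -, -, -, rfl, rfl, rfl, rfl⟩ := hcirc
  clear hdist
  obtain ⟨a, rfl⟩ : ∃ a, tA = 2 * a := ⟨tA / 2, by ring⟩
  obtain ⟨b, rfl⟩ : ∃ a, tB = 2 * a := ⟨tB / 2, by ring⟩
  obtain ⟨c, rfl⟩ : ∃ a, tC = 2 * a := ⟨tC / 2, by ring⟩
  obtain ⟨d, rfl⟩ : ∃ a, tD = 2 * a := ⟨tD / 2, by ring⟩
  simp only [chordAux, areaAux]
  have h1 := sinAux (b-a) (c-b) (d-c)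
  have h2 := sinAux2 (b-a) (c-b) (d-c)
  rw [show c - b + (d - c) = d - b by ring, show b - a + (c - b) = c - a by ring] at h1 h2
  rw [show c - a + (d - c) = d - a by ring] at h1
  generalize Real.sin (b-a-(d-c)) = z at *
  generalize Real.sin (b-a) = ab at *
  generalize Real.sin (c-a) = ac at *
  generalize Real.sin (d-a) = ad at *
  generalize Real.sin (c-b) = bc at *
  generalize Real.sin (d-b) = bd at *
  generalize Real.sin (d-c) = cd at *
  linear_combination 128 * R^6 * ab * ac * bd * cd * (bc * h1 + ad * h2)
end

section
/- Let n ≥ 2 be an integer and let A_0, A_1, …, A_n be points in ℝ² lying on a circle in anticlockwise order. Writing δ_{ij} for the distance between A_i and A_j, one has δ_{0,n−1} / (δ_{0,n}·δ_{n,n−1}) = Σ_{i=1}^{n−1} δ_{i−1,i} / (δ_{i−1,n}·δ_{n,i}). -/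
open Finset

lemma pdist_aux (O : ℝ × ℝ) (R : ℝ) (hR : 0 < R) (x y : ℝ) (h1 : x ≤ y)
    (h2 : y ≤ x + 2 * Real.pi) :
    pdist (O.1 + R * Real.cos x, O.2 + R * Real.sin x)
      (O.1 + R * Real.cos y, O.2 + R * Real.sin y) = 2 * R * Real.sin ((y - x) / 2) := by
  have hs : 0 ≤ Real.sin ((y - x) / 2) :=
    Real.sin_nonneg_of_nonneg_of_le_pi (by linarith) (by linarith)
  unfold pdist sqDist
  rw [Real.sqrt_eq_iff_mul_self_eq (by positivity) (by positivity)]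
  have h := Real.cos_sq ((y - x) / 2)
  rw [show 2 * ((y - x) / 2) = y - x by ring] at h
  have h3 := Real.sin_sq_add_cos_sq ((y - x) / 2)
  have h4 := Real.cos_sub y x
  have h5 := Real.sin_sq_add_cos_sq x
  have h6 := Real.sin_sq_add_cos_sq y
  have h7 : Real.sin ((y - x) / 2) ^ 2 = 1 / 2 - (Real.cos y * Real.cos x + Real.sin y * Real.sin x) / 2 := by
    rw [← h4]; linarith
  linear_combination -4 * R ^ 2 * h7 + R ^ 2 * h5 + R ^ 2 * h6

lemma pdist_comm_aux (P Q : ℝ × ℝ) : pdist P Q = pdist Q P := by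
  unfold pdist sqDist
  congr 1
  ring

lemma term_aux (O : ℝ × ℝ) (R : ℝ) (hR : 0 < R) (x y d : ℝ) (h1 : x ≤ y) (h2 : y < d)
    (h3 : d < x + 2 * Real.pi) (X Y D : ℝ × ℝ)
    (hX : X = (O.1 + R * Real.cos x, O.2 + R * Real.sin x))
    (hY : Y = (O.1 + R * Real.cos y, O.2 + R * Real.sin y))
    (hD : D = (O.1 + R * Real.cos d, O.2 + R * Real.sin d)) :
    pdist X Y / (pdist X D * pdist D Y) =
      Real.cos ((d - y) / 2) / Real.sin ((d - y) / 2) / (2 * R)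
        - Real.cos ((d - x) / 2) / Real.sin ((d - x) / 2) / (2 * R) := by
  rw [pdist_comm_aux D Y, hX, hY, hD, pdist_aux O R hR x y h1 (by linarith),
    pdist_aux O R hR x d (by linarith) (by linarith),
    pdist_aux O R hR y d (by linarith) (by linarith)]
  have e : (y - x) / 2 = (d - x) / 2 - (d - y) / 2 := by ring
  have a : 0 < Real.sin ((d - x) / 2) :=
    Real.sin_pos_of_pos_of_lt_pi (by linarith) (by linarith)
  have b : 0 < Real.sin ((d - y) / 2) :=
    Real.sin_pos_of_pos_of_lt_pi (by linarith) (by linarith)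
  rw [e, Real.sin_sub]
  generalize Real.sin ((d - x) / 2) = s at *
  generalize Real.sin ((d - y) / 2) = t at *
  field_simp

theorem stmt18 (n : ℕ) (hn : 2 ≤ n) (A : ℕ → ℝ × ℝ)
    (hcirc : AnticlockwiseN A 0 n) :
    pdist (A 0) (A (n-1)) / (pdist (A 0) (A n) * pdist (A n) (A (n-1))) =
      ∑ i ∈ Finset.Icc 1 (n-1),
        pdist (A (i-1)) (A i) / (pdist (A (i-1)) (A n) * pdist (A n) (A i)) := by
  obtain ⟨O, R, θ, hR, hlt, hpi, hA⟩ := hcirc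
  have mono : ∀ j, j ≤ n → ∀ i, i ≤ j → θ i ≤ θ j := by
    intro j
    induction j with
    | zero => intro _ i hi; rw [Nat.le_zero.mp hi]
    | succ k ih =>
      intro hk i hi
      rcases Nat.lt_or_ge i (k + 1) with h | h
      · exact (ih (by omega) i (by omega)).trans (hlt k (by omega) (by omega)).le
      · rw [le_antisymm hi h]
  have key : ∀ i j, i ≤ j → j < n → pdist (A i) (A j) / (pdist (A i) (A n) * pdist (A n) (A j)) =
      Real.cos ((θ n - θ j) / 2) / Real.sin ((θ n - θ j) / 2) / (2 * R)
        - Real.cos ((θ n - θ i) / 2) / Real.sin ((θ n - θ i) / 2) / (2 * R) := by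
    intro i j hij hj
    have h1 := mono j hj.le i hij
    have h2 := hlt j (by omega) hj
    have h3 := mono n le_rfl (j + 1) hj
    have h4 := mono i (by omega) 0 (by omega)
    exact term_aux O R hR (θ i) (θ j) (θ n) h1 (by linarith) (by linarith) _ _ _
      (hA i (by omega) (by omega)) (hA j (by omega) (by omega)) (hA n (by omega) le_rfl)
  have main : ∀ m, m < n → pdist (A 0) (A m) / (pdist (A 0) (A n) * pdist (A n) (A m)) =
      ∑ i ∈ Finset.Icc 1 m,
        pdist (A (i-1)) (A i) / (pdist (A (i-1)) (A n) * pdist (A n) (A i)) := by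
    intro m
    induction m with
    | zero => intro h; rw [key 0 0 le_rfl h]; simp
    | succ k ih =>
      intro h
      rw [Finset.sum_Icc_succ_top (by omega), ← ih (by omega), Nat.add_sub_cancel,
        key 0 (k + 1) (by omega) h, key 0 k (by omega) (by omega), key k (k + 1) (by omega) h]
      ring
  exact main (n - 1) (by omega)
end

section
/- Let A_1, A_2, A_3, A_4 be arbitrary points in ℝ². Set a := x_{14}, b := x_{12}, c := x_{23}, d := x_{34}, e := x_{13}, f := x_{24}, p := S_{123}, q := S_{134}, r := S_{124}, s := S_{234}. Then the ten numbers (a,b,c,d,e,f,p,q,r,s) form a Heronian diamond; that is, all seven equations hold: p² = H(b,c,e), q² = H(a,d,e), r² = H(a,f,b), s² = H(c,f,d), r + s = p + q, 4ef = (p+q)² + (a−b+c−d)², and e(r−s) = p(a−d) + q(b−c). -/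
/-- The Heron-type polynomial `H(x,y,z)`. -/
noncomputable def Hpoly (x y z : ℝ) : ℝ :=
  -x^2 - y^2 - z^2 + 2*x*y + 2*x*z + 2*y*z

theorem stmt19 (A₁ A₂ A₃ A₄ : ℝ × ℝ) :
    (S4 A₁ A₂ A₃)^2 = Hpoly (sqDist A₁ A₂) (sqDist A₂ A₃) (sqDist A₁ A₃) ∧
    (S4 A₁ A₃ A₄)^2 = Hpoly (sqDist A₁ A₄) (sqDist A₃ A₄) (sqDist A₁ A₃) ∧
    (S4 A₁ A₂ A₄)^2 = Hpoly (sqDist A₁ A₄) (sqDist A₂ A₄) (sqDist A₁ A₂) ∧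
    (S4 A₂ A₃ A₄)^2 = Hpoly (sqDist A₂ A₃) (sqDist A₂ A₄) (sqDist A₃ A₄) ∧
    S4 A₁ A₂ A₄ + S4 A₂ A₃ A₄ = S4 A₁ A₂ A₃ + S4 A₁ A₃ A₄ ∧
    4 * sqDist A₁ A₃ * sqDist A₂ A₄ =
      (S4 A₁ A₂ A₃ + S4 A₁ A₃ A₄)^2 +
        (sqDist A₁ A₄ - sqDist A₁ A₂ + sqDist A₂ A₃ - sqDist A₃ A₄)^2 ∧
    sqDist A₁ A₃ * (S4 A₁ A₂ A₄ - S4 A₂ A₃ A₄) =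
      S4 A₁ A₂ A₃ * (sqDist A₁ A₄ - sqDist A₃ A₄) +
        S4 A₁ A₃ A₄ * (sqDist A₁ A₂ - sqDist A₂ A₃) := by
  obtain ⟨a1, a2⟩ := A₁
  obtain ⟨b1, b2⟩ := A₂
  obtain ⟨c1, c2⟩ := A₃
  obtain ⟨d1, d2⟩ := A₄
  simp only [S4, sqDist, Hpoly]
  refine ⟨?_, ?_, ?_, ?_, ?_, ?_, ?_⟩ <;> ring
end
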